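/- Let 1 < p < ∞, let W be a matrix A_p weight on ℝ^d with reducing operators V_I, and let f⃗ ∈ C_c^∞(ℝ^d; ℂ^n). Then ( ∫_{ℝ^d} ( ∑_{I ∈ 𝒟} ∑_{ε ∈ 𝒮} |V_I^{−1} f⃗_I^ε|² |I|^{−1} χ_I(x) )^{p'/2} dx )^{1/p'} ≤ C ‖W‖_{A_p}^{1/p + ⌈p⌉/p} ‖W^{−1/p} f⃗‖_{L^{p'}}, where p' = p/(p−1), ⌈p⌉ is the smallest integer ≥ p, and C depends only on p, n, d. -/

import Mathlib

open MeasureTheory ENNReal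
open scoped ComplexOrder

noncomputable section

/-! ## Basic linear-algebra notation -/

/-- The operator norm of an `n × n` complex matrix, viewed as an operator on the
Euclidean space `ℂⁿ`. -/
def matNorm {n : ℕ} (M : Matrix (Fin n) (Fin n) ℂ) : ℝ :=
  ‖Matrix.toEuclideanCLM (𝕜 := ℂ) (n := Fin n) M‖

/-- A matrix applied to a vector of `ℂⁿ` (with its Euclidean norm). -/
def mApp {n : ℕ} (M : Matrix (Fin n) (Fin n) ℂ) (v : EuclideanSpace ℂ (Fin n)) :
    EuclideanSpace ℂ (Fin n) :=
  Matrix.toEuclideanCLM (𝕜 := ℂ) (n := Fin n) M v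


/-- Entrywise measurability of a matrix-valued function. -/
def MatMeasurable {d n : ℕ} (W : (Fin d → ℝ) → Matrix (Fin n) (Fin n) ℂ) : Prop :=
  ∀ i j, Measurable fun x => W x i j

/-! ## Dyadic cubes and Haar functions -/

/-- A dyadic cube in `ℝ^d`, with side length `2^k` and lower-left corner `(m i * 2^k)_i`. -/
structure DCube (d : ℕ) where
  k : ℤ
  m : Fin d → ℤ

namespace DCube

variable {d : ℕ}

/-- The (half-open) cube in `ℝ^d` determined by a dyadic cube. -/
def set (I : DCube d) : Set (Fin d → ℝ) :=
  {x | ∀ i, (I.m i : ℝ) * 2 ^ I.k ≤ x i ∧ x i < ((I.m i : ℝ) + 1) * 2 ^ I.k}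

/-- The volume `|I| = (2^k)^d` of a dyadic cube. -/
def vol (I : DCube d) : ℝ := ((2 : ℝ) ^ I.k) ^ d

/-- The lower-left corner of a dyadic cube. -/
def corner (I : DCube d) : Fin d → ℝ := fun i => (I.m i : ℝ) * 2 ^ I.k

/-- The side length of a dyadic cube. -/
def side (I : DCube d) : ℝ := (2 : ℝ) ^ I.k

end DCube

/-- One-dimensional Haar functions on the dyadic interval `[m·2^k, (m+1)·2^k)`:
`haar1D true` is the non-cancellative `|I|^{-1/2} χ_I`, while `haar1D false` is
`|I|^{-1/2} (χ_{I_ℓ} - χ_{I_r})`. -/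
def haar1D (ε : Bool) (k mm : ℤ) (t : ℝ) : ℝ :=
  if ε then
    Set.indicator {s : ℝ | (mm : ℝ) * 2 ^ k ≤ s ∧ s < ((mm : ℝ) + 1) * 2 ^ k}
      (fun _ => ((2 : ℝ) ^ k) ^ (-(1 / 2 : ℝ))) t
  else
    Set.indicator {s : ℝ | (mm : ℝ) * 2 ^ k ≤ s ∧ s < (mm : ℝ) * 2 ^ k + 2 ^ (k - 1)}
      (fun _ => ((2 : ℝ) ^ k) ^ (-(1 / 2 : ℝ))) t -
    Set.indicator {s : ℝ | (mm : ℝ) * 2 ^ k + 2 ^ (k - 1) ≤ s ∧ s < ((mm : ℝ) + 1) * 2 ^ k}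
      (fun _ => ((2 : ℝ) ^ k) ^ (-(1 / 2 : ℝ))) t

/-- The signature set `𝒮 = {0,1}^d \ {(1,…,1)}` indexing the cancellative Haar functions. -/
def Sfin (d : ℕ) : Finset (Fin d → Bool) := Finset.univ.erase (fun _ => true)

/-- The Haar function `h_I^ε = ∏ i, h_{I_i}^{ε_i}` associated to a dyadic cube `I ⊂ ℝ^d`
and a signature `ε ∈ {0,1}^d`. -/
def haarFn {d : ℕ} (I : DCube d) (ε : Fin d → Bool) (x : Fin d → ℝ) : ℝ :=
  ∏ i, haar1D (ε i) I.k (I.m i) (x i)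

/-- The (vector of) Haar coefficients `f_I^ε = ∫ f h_I^ε` of a `ℂⁿ`-valued function. -/
def haarCoef {d n : ℕ} (f : (Fin d → ℝ) → EuclideanSpace ℂ (Fin n)) (I : DCube d)
    (ε : Fin d → Bool) : EuclideanSpace ℂ (Fin n) :=
  ∫ x, haarFn I ε x • f x

/-! ## Matrix `A_p` weights and reducing operators -/

/-- The (closed, axis-parallel) cube with corner `c` and side length `r`. -/
def cubeSet {d : ℕ} (c : Fin d → ℝ) (r : ℝ) : Set (Fin d → ℝ) :=
  {x | ∀ i, c i ≤ x i ∧ x i ≤ c i + r}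

/-- The matrix `A_p` characteristic `‖W‖_{A_p}` of a matrix weight `W`, expressed in terms of
`W1p = W^{1/p}` (so that `W^{-1/p} = (W1p)⁻¹`):
`sup_I (1/|I|) ∫_I ((1/|I|) ∫_I ‖W^{1/p}(x) W^{-1/p}(t)‖^{p'} dt)^{p/p'} dx`,
the supremum being over all cubes `I ⊂ ℝ^d`.  Here `p' = p/(p-1)` and `p/p' = p - 1`. -/
def apNorm {d n : ℕ} (p : ℝ) (W1p : (Fin d → ℝ) → Matrix (Fin n) (Fin n) ℂ) : ℝ≥0∞ :=
  ⨆ (c : Fin d → ℝ) (r : ℝ) (_ : 0 < r),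
    (ENNReal.ofReal (r ^ d))⁻¹ *
      ∫⁻ x in cubeSet c r,
        ((ENNReal.ofReal (r ^ d))⁻¹ *
            ∫⁻ t in cubeSet c r,
              ENNReal.ofReal (matNorm (W1p x * (W1p t)⁻¹)) ^ (p / (p - 1))) ^ (p - 1)

/-- The `L^q` average `(|I|^{-1} ∫_I ‖A(x) e‖^q dx)^{1/q}` over a dyadic cube. -/
def redAvgD {d n : ℕ} (q : ℝ) (A : (Fin d → ℝ) → Matrix (Fin n) (Fin n) ℂ) (I : DCube d)
    (e : EuclideanSpace ℂ (Fin n)) : ℝ≥0∞ :=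
  ((ENNReal.ofReal I.vol)⁻¹ * ∫⁻ x in I.set, ENNReal.ofReal ‖mApp (A x) e‖ ^ q) ^ (1 / q)

/-- `V` is a family of reducing operators for the weight `W = (W1p)^p` (indexed by dyadic
cubes), with comparability constants `c₁, c₂`:  each `V I` is positive definite and
`|V_I e| ≈ (|I|^{-1} ∫_I |W^{1/p}(x) e|^p dx)^{1/p}`. -/
def IsReducing {d n : ℕ} (p c₁ c₂ : ℝ) (W1p : (Fin d → ℝ) → Matrix (Fin n) (Fin n) ℂ)
    (V : DCube d → Matrix (Fin n) (Fin n) ℂ) : Prop :=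
  ∀ I : DCube d, (V I).PosDef ∧ ∀ e : EuclideanSpace ℂ (Fin n),
    ENNReal.ofReal c₁ * redAvgD p W1p I e ≤ ENNReal.ofReal ‖mApp (V I) e‖ ∧
    ENNReal.ofReal ‖mApp (V I) e‖ ≤ ENNReal.ofReal c₂ * redAvgD p W1p I e

/-- `V'` is a family of dual reducing operators for the weight `W = (W1p)^p`:
`|V_I' e| ≈ (|I|^{-1} ∫_I |W^{-1/p}(x) e|^{p'} dx)^{1/p'}` with `p' = p/(p-1)`. -/
def IsDualReducing {d n : ℕ} (p c₁ c₂ : ℝ) (W1p : (Fin d → ℝ) → Matrix (Fin n) (Fin n) ℂ)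
    (V' : DCube d → Matrix (Fin n) (Fin n) ℂ) : Prop :=
  ∀ I : DCube d, (V' I).PosDef ∧ ∀ e : EuclideanSpace ℂ (Fin n),
    ENNReal.ofReal c₁ * redAvgD (p / (p - 1)) (fun x => (W1p x)⁻¹) I e ≤
        ENNReal.ofReal ‖mApp (V' I) e‖ ∧
    ENNReal.ofReal ‖mApp (V' I) e‖ ≤
        ENNReal.ofReal c₂ * redAvgD (p / (p - 1)) (fun x => (W1p x)⁻¹) I e

/-- The `L^p(W)` norm `(∫ |W^{1/p}(x) f(x)|^p dx)^{1/p}` (as a value in `[0,∞]`). -/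
def wNorm {d n : ℕ} (p : ℝ) (W1p : (Fin d → ℝ) → Matrix (Fin n) (Fin n) ℂ)
    (f : (Fin d → ℝ) → EuclideanSpace ℂ (Fin n)) : ℝ≥0∞ :=
  (∫⁻ x, ENNReal.ofReal ‖mApp (W1p x) (f x)‖ ^ p) ^ (1 / p)

/-- The square-function expression
`∑_{I ∈ 𝒟} ∑_{ε ∈ 𝒮} |A_I f_I^ε|² |I|^{-1} χ_I(x)` for a family of matrices `A_I`. -/
def sqFn {d n : ℕ} (A : DCube d → Matrix (Fin n) (Fin n) ℂ)
    (f : (Fin d → ℝ) → EuclideanSpace ℂ (Fin n)) (x : Fin d → ℝ) : ℝ≥0∞ :=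
  ∑' I : DCube d, ∑ ε ∈ Sfin d,
    Set.indicator I.set
      (fun _ => ENNReal.ofReal (‖mApp (A I) (haarCoef f I ε)‖ ^ 2) / ENNReal.ofReal I.vol) x

/-! ## Stopping times -/

/-- A stopping time assigns to each dyadic cube `I` a collection `𝒥 I` of pairwise disjoint
dyadic subcubes of `I`. -/
def IsStopping {d : ℕ} (𝒥 : DCube d → Set (DCube d)) : Prop :=
  ∀ I : DCube d, (∀ J ∈ 𝒥 I, J.set ⊆ I.set) ∧
    (𝒥 I).Pairwise fun J K => Disjoint J.set K.set

/-- `ℱ(I)`: the dyadic subcubes of `I` not contained in any stopping cube `J ∈ 𝒥(I)`. -/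
def Fcol {d : ℕ} (𝒥 : DCube d → Set (DCube d)) (I : DCube d) : Set (DCube d) :=
  {J | J.set ⊆ I.set ∧ ∀ K ∈ 𝒥 I, ¬J.set ⊆ K.set}

/-- A stopping time is admissible if `I ∈ ℱ(I)` for every `I`. -/
def Admissible {d : ℕ} (𝒥 : DCube d → Set (DCube d)) : Prop :=
  ∀ I : DCube d, I ∈ Fcol 𝒥 I

/-- The iterated stopping collections: `𝒥^0(I) = {I}` and
`𝒥^{j+1}(I) = ⋃_{J ∈ 𝒥^j(I)} 𝒥(J)`. -/
def JIter {d : ℕ} (𝒥 : DCube d → Set (DCube d)) : ℕ → DCube d → Set (DCube d)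
  | 0, I => {I}
  | j + 1, I => ⋃ J ∈ JIter 𝒥 j I, 𝒥 J

/-- A stopping time is decaying with constant `c` if
`∑_{J ∈ 𝒥(I)} |J| ≤ c |I|` for every `I`. -/
def Decaying {d : ℕ} (c : ℝ) (𝒥 : DCube d → Set (DCube d)) : Prop :=
  ∀ I : DCube d,
    ∑' J : 𝒥 I, ENNReal.ofReal (J : DCube d).vol ≤ ENNReal.ofReal c * ENNReal.ofReal I.vol

/-- `ℱ^j = ℱ^j(I₀) = ⋃_{J ∈ 𝒥^{j-1}(I₀)} ℱ(J)` (intended for `j ≥ 1`). -/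
def Fj {d : ℕ} (𝒥 : DCube d → Set (DCube d)) (I₀ : DCube d) (j : ℕ) : Set (DCube d) :=
  ⋃ J ∈ JIter 𝒥 (j - 1) I₀, Fcol 𝒥 J

/-- The Haar projection `Δ_j f = ∑_{I ∈ ℱ^j} ∑_{ε ∈ 𝒮} f_I^ε h_I^ε`. -/
def deltaHaar {d n : ℕ} (𝒥 : DCube d → Set (DCube d)) (I₀ : DCube d) (j : ℕ)
    (f : (Fin d → ℝ) → EuclideanSpace ℂ (Fin n)) (x : Fin d → ℝ) :
    EuclideanSpace ℂ (Fin n) :=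
  ∑' I : Fj 𝒥 I₀ j, ∑ ε ∈ Sfin d, haarFn (I : DCube d) ε x • haarCoef f (I : DCube d) ε

/-! ## Constant Haar multipliers -/

/-- `∑_{I ∈ S} ∑_{ε ∈ 𝒮} V_I^{-1} f_I^ε h_I^ε(x)`. -/
def projInv {d n : ℕ} (V : DCube d → Matrix (Fin n) (Fin n) ℂ) (S : Set (DCube d))
    (f : (Fin d → ℝ) → EuclideanSpace ℂ (Fin n)) (x : Fin d → ℝ) :
    EuclideanSpace ℂ (Fin n) :=
  ∑' I : S, ∑ ε ∈ Sfin d,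
    haarFn (I : DCube d) ε x • mApp ((V (I : DCube d))⁻¹) (haarCoef f (I : DCube d) ε)

/-- A function has finite Haar expansion if it is a finite sum of Haar functions. -/
def FiniteHaar {d n : ℕ} (f : (Fin d → ℝ) → EuclideanSpace ℂ (Fin n)) : Prop :=
  ∃ F : Finset (DCube d × (Fin d → Bool)),
    ∀ x, f x = ∑ q ∈ F, haarFn q.1 q.2 x • haarCoef f q.1 q.2

/-! ## The weighted stopping time -/

/-- The stopping condition `‖V_J V_I^{-1}‖^p > λ₁` or `‖V_J^{-1} V_I‖^{p'} > λ₂`. -/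
def stopBad {d n : ℕ} (p l₁ l₂ : ℝ) (V : DCube d → Matrix (Fin n) (Fin n) ℂ)
    (J I : DCube d) : Prop :=
  l₁ < matNorm (V J * (V I)⁻¹) ^ p ∨ l₂ < matNorm ((V J)⁻¹ * V I) ^ (p / (p - 1))

/-- The stopping time `𝒥(I)` = maximal dyadic subcubes `J ⊆ I` satisfying `stopBad`. -/
def stopST {d n : ℕ} (p l₁ l₂ : ℝ) (V : DCube d → Matrix (Fin n) (Fin n) ℂ)
    (I : DCube d) : Set (DCube d) :=
  {J | J.set ⊆ I.set ∧ stopBad p l₁ l₂ V J I ∧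
    ∀ K : DCube d, K.set ⊆ I.set → stopBad p l₁ l₂ V K I → J.set ⊆ K.set → K = J}


namespace DCube

variable {d : ℕ}

@[ext]
theorem ext_km {I J : DCube d} (hk : I.k = J.k) (hm : I.m = J.m) : I = J := by
  cases I; cases J; simp_all

/-- The dyadic cube of side `2 ^ k` containing the point `x`. -/
def atPt (k : ℤ) (x : Fin d → ℝ) : DCube d := ⟨k, fun i => ⌊x i / 2 ^ k⌋⟩

@[simp] theorem atPt_k (k : ℤ) (x : Fin d → ℝ) : (atPt k x).k = k := rfl

theorem mem_set_iff {I : DCube d} {x : Fin d → ℝ} : x ∈ I.set ↔ atPt I.k x = I := by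
  have h2 : (0 : ℝ) < 2 ^ I.k := by positivity
  have key : ∀ i, ((I.m i : ℝ) * 2 ^ I.k ≤ x i ∧ x i < ((I.m i : ℝ) + 1) * 2 ^ I.k) ↔
      ⌊x i / 2 ^ I.k⌋ = I.m i := by
    intro i
    rw [Int.floor_eq_iff, le_div_iff₀ h2, div_lt_iff₀ h2]
  simp only [DCube.set, Set.mem_ofPred_eq, key]
  constructor
  · intro h
    exact ext_km rfl (funext h)
  · intro h i
    exact congrFun (congrArg DCube.m h) i

theorem mem_atPt (k : ℤ) (x : Fin d → ℝ) : x ∈ (atPt k x).set := mem_set_iff.2 rfl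

theorem atPt_succ_eq {k : ℤ} {x y : Fin d → ℝ} (h : atPt k x = atPt k y) :
    atPt (k + 1) x = atPt (k + 1) y := by
  have key : ∀ z : Fin d → ℝ, ∀ i, ⌊z i / 2 ^ (k + 1)⌋ = ⌊z i / 2 ^ k⌋ / (2 : ℕ) := by
    intro z i
    rw [← Int.floor_div_natCast, zpow_add_one₀ (by norm_num), div_div]
    norm_num
  refine ext_km rfl (funext fun i => ?_)
  have hi : ⌊x i / 2 ^ k⌋ = ⌊y i / 2 ^ k⌋ := congrFun (congrArg DCube.m h) i
  change ⌊x i / 2 ^ (k + 1)⌋ = ⌊y i / 2 ^ (k + 1)⌋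
  rw [key, key, hi]

theorem atPt_eq_of_le {k l : ℤ} (hkl : k ≤ l) {x y : Fin d → ℝ} (h : atPt k x = atPt k y) :
    atPt l x = atPt l y := by
  induction l, hkl using Int.leInduction with
  | base => exact h
  | succ l _ ih => exact atPt_succ_eq ih

theorem atPt_injective (x : Fin d → ℝ) : Function.Injective fun k => atPt k x :=
  fun _ _ h => congrArg DCube.k h

instance : Countable (DCube d) :=
  Function.Injective.countable (f := fun I : DCube d => (I.k, I.m))
    fun _ _ h => ext_km (congrArg Prod.fst h) (congrArg Prod.snd h)

instance : MeasurableSpace (DCube d) := ⊤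

theorem set_eq_pi (I : DCube d) : I.set = Set.pi Set.univ fun i =>
    Set.Ico ((I.m i : ℝ) * 2 ^ I.k) (((I.m i : ℝ) + 1) * 2 ^ I.k) := by
  ext x
  simp [DCube.set]

theorem measurableSet_set (I : DCube d) : MeasurableSet I.set := by
  rw [set_eq_pi]
  exact MeasurableSet.univ_pi fun _ => measurableSet_Ico

theorem vol_pos (I : DCube d) : 0 < I.vol := by unfold vol; positivity

theorem volume_set (I : DCube d) : volume I.set = ENNReal.ofReal I.vol := by
  rw [set_eq_pi, Real.volume_pi_Ico, vol, ENNReal.ofReal_pow (by positivity)]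
  have : ∀ i, ((I.m i : ℝ) + 1) * 2 ^ I.k - (I.m i : ℝ) * 2 ^ I.k = 2 ^ I.k := by intro i; ring
  simp [this]

theorem measurable_atPt (k : ℤ) : Measurable (atPt (d := d) k) := by
  refine measurable_to_countable' fun I => ?_
  by_cases hk : I.k = k
  · have : atPt k ⁻¹' {I} = I.set := by
      ext x
      rw [mem_set_iff, hk]
      rfl
    rw [this]
    exact I.measurableSet_set
  · have : atPt k ⁻¹' {I} = ∅ := by
      ext x
      simp only [Set.mem_preimage, Set.mem_singleton_iff, Set.mem_empty_iff_false, iff_false]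
      intro h
      exact hk (by rw [← h]; rfl)
    rw [this]
    exact MeasurableSet.empty

theorem measurable_of_atPt {β : Type*} [MeasurableSpace β] [Nonempty β] {k : ℤ}
    {h : (Fin d → ℝ) → β} (hh : ∀ x y, atPt k x = atPt k y → h x = h y) : Measurable h := by
  have hf : Function.FactorsThrough h (atPt k) := fun x y hxy => hh x y hxy
  obtain ⟨e, he⟩ := (Function.factorsThrough_iff (h)).1 hf
  rw [he]
  exact (measurable_from_top (f := e)).comp (measurable_atPt k)

theorem measurableSet_of_atPt {k : ℤ} {P : (Fin d → ℝ) → Prop}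
    (hh : ∀ x y, atPt k x = atPt k y → (P x ↔ P y)) : MeasurableSet {x | P x} :=
  measurableSet_setOfPred.2 (measurable_of_atPt fun x y h => propext (hh x y h))

/-- The `2 ^ d` dyadic children of a dyadic cube. -/
def child (I : DCube d) (b : Fin d → Bool) : DCube d :=
  ⟨I.k - 1, fun i => 2 * I.m i + if b i then 1 else 0⟩

@[simp] theorem child_k (I : DCube d) (b : Fin d → Bool) : (I.child b).k = I.k - 1 := rfl

theorem vol_eq_child (I : DCube d) (b : Fin d → Bool) : I.vol = 2 ^ d * (I.child b).vol := by
  unfold vol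
  rw [child_k, ← mul_pow, ← zpow_one_add₀ (by norm_num)]
  ring_nf

theorem mem_child_iff {I : DCube d} {b : Fin d → Bool} {x : Fin d → ℝ} :
    x ∈ (I.child b).set ↔ x ∈ I.set ∧
      ∀ i, b i = true ↔ (I.m i : ℝ) * 2 ^ I.k + 2 ^ (I.k - 1) ≤ x i := by
  have h2 : (0 : ℝ) < 2 ^ (I.k - 1) := by positivity
  have e : (2 : ℝ) ^ I.k = 2 * 2 ^ (I.k - 1) := by
    rw [← zpow_one_add₀ (by norm_num)]; ring_nf
  simp only [DCube.set, Set.mem_ofPred_eq, child, ← forall_and]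
  refine forall_congr' fun i => ?_
  cases b i
  · push_cast
    simp only [false_iff, not_le, e]
    constructor
    · rintro ⟨h, h'⟩
      exact ⟨⟨by linarith, by nlinarith⟩, by linarith⟩
    · rintro ⟨⟨h, h'⟩, h''⟩
      exact ⟨by linarith, by linarith⟩
  · push_cast
    simp only [if_true, true_iff, e]
    constructor
    · rintro ⟨h, h'⟩
      exact ⟨⟨by nlinarith, by linarith⟩, by linarith⟩
    · rintro ⟨⟨h, h'⟩, h''⟩
      exact ⟨by linarith, by linarith⟩

theorem child_subset (I : DCube d) (b : Fin d → Bool) : (I.child b).set ⊆ I.set :=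
  fun _ h => (mem_child_iff.1 h).1

theorem iUnion_child (I : DCube d) : ⋃ b, (I.child b).set = I.set := by
  refine Set.Subset.antisymm (Set.iUnion_subset I.child_subset) fun x hx => ?_
  refine Set.mem_iUnion.2
    ⟨fun i => decide ((I.m i : ℝ) * 2 ^ I.k + 2 ^ (I.k - 1) ≤ x i), mem_child_iff.2 ⟨hx, ?_⟩⟩
  simp

theorem pairwise_disjoint_child (I : DCube d) :
    Pairwise (Function.onFun Disjoint fun b => (I.child b).set) := by
  intro b b' hb
  refine Set.disjoint_left.2 fun x hx hx' => hb (funext fun i => ?_)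
  rw [Bool.eq_iff_iff, (mem_child_iff.1 hx).2 i, (mem_child_iff.1 hx').2 i]

theorem lintegral_child (I : DCube d) (μ : Measure (Fin d → ℝ)) (h : (Fin d → ℝ) → ℝ≥0∞) :
    ∫⁻ x in I.set, h x ∂μ = ∑ b, ∫⁻ x in (I.child b).set, h x ∂μ := by
  rw [← iUnion_child, lintegral_iUnion (fun b => measurableSet_set _)
    (pairwise_disjoint_child I), tsum_fintype]

theorem measure_inter_child (I : DCube d) (μ : Measure (Fin d → ℝ)) (s : Set (Fin d → ℝ)) :
    μ (I.set ∩ s) = ∑ b, μ ((I.child b).set ∩ s) := by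
  have := I.lintegral_child (μ.restrict s) 1
  simpa [Measure.restrict_apply (measurableSet_set _)] using this

theorem integral_child {E : Type*} [NormedAddCommGroup E] [NormedSpace ℝ E] (I : DCube d)
    {F : (Fin d → ℝ) → E} (hF : Integrable F) :
    ∫ x in I.set, F x = ∑ b, ∫ x in (I.child b).set, F x := by
  rw [← iUnion_child, integral_iUnion_fintype (fun b => measurableSet_set _)
    (pairwise_disjoint_child I) (fun b => hF.integrableOn)]

theorem atPt_of_mem {I : DCube d} {x : Fin d → ℝ} (h : x ∈ I.set) {k : ℤ} (hk : I.k = k) :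
    atPt k x = I := by rw [← hk]; exact mem_set_iff.1 h

/-- Comparison of integrals over the whole space from comparison on all cubes of one scale. -/
theorem lintegral_le_of_cubes (k : ℤ) (h h' : (Fin d → ℝ) → ℝ≥0∞)
    (H : ∀ I : DCube d, I.k = k → ∫⁻ x in I.set, h x ≤ ∫⁻ x in I.set, h' x) :
    ∫⁻ x, h x ≤ ∫⁻ x, h' x := by
  have hU : (⋃ m : Fin d → ℤ, (⟨k, m⟩ : DCube d).set) = Set.univ :=
    Set.eq_univ_of_forall fun x => Set.mem_iUnion.2 ⟨fun i => ⌊x i / 2 ^ k⌋, mem_atPt k x⟩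
  have hd : Pairwise (Function.onFun Disjoint fun m : Fin d → ℤ => (⟨k, m⟩ : DCube d).set) := by
    intro m m' hm
    refine Set.disjoint_left.2 fun x hx hx' => hm ?_
    have h1 := mem_set_iff.1 hx
    have h2 := mem_set_iff.1 hx'
    exact congrArg DCube.m (h1.symm.trans h2)
  rw [← setLIntegral_univ, ← setLIntegral_univ (μ := volume) h', ← hU,
    lintegral_iUnion (fun m => measurableSet_set _) hd,
    lintegral_iUnion (fun m => measurableSet_set _) hd]
  exact ENNReal.tsum_le_tsum fun m => H _ rfl

end DCube

section HaarEnergy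

variable {d n : ℕ}

/-- The sign of the Haar function of signature `ε` on the child indexed by `b`. -/
def haarSign (ε b : Fin d → Bool) : ℝ := ∏ i, if ε i then 1 else if b i then -1 else 1

theorem abs_haarSign (ε b : Fin d → Bool) : |haarSign ε b| = 1 := by
  rw [haarSign, Finset.abs_prod]
  refine Finset.prod_eq_one fun i _ => ?_
  split_ifs <;> simp

theorem sum_haarSign {ε : Fin d → Bool} (hε : ε ∈ Sfin d) : ∑ b, haarSign ε b = 0 := by
  have hne : ε ≠ fun _ => true := (Finset.mem_erase.1 hε).1
  obtain ⟨i, hi⟩ := Function.ne_iff.1 hne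
  have := (Finset.prod_univ_sum (κ := fun _ : Fin d => Bool) (fun _ => Finset.univ)
    (fun i b => if ε i then (1 : ℝ) else if b then -1 else 1)).symm
  rw [Fintype.piFinset_univ] at this
  unfold haarSign
  rw [this]
  refine Finset.prod_eq_zero (Finset.mem_univ i) ?_
  simp [Bool.eq_false_iff.2 hi]

/-- The common absolute value of the Haar functions of a cube. -/
def haarScale (I : DCube d) : ℝ := (((2 : ℝ) ^ I.k) ^ (-(1 / 2 : ℝ))) ^ d

theorem haarScale_nonneg (I : DCube d) : 0 ≤ haarScale I := by unfold haarScale; positivity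

theorem haarScale_sq (I : DCube d) : haarScale I ^ 2 = I.vol⁻¹ := by
  have h : (0 : ℝ) ≤ 2 ^ I.k := by positivity
  rw [haarScale, DCube.vol, ← pow_mul, mul_comm, pow_mul, ← inv_pow]
  congr 1
  rw [← Real.rpow_natCast, ← Real.rpow_mul h]
  norm_num
  rw [Real.rpow_neg_one]

theorem haar1D_of_mem {ε b : Bool} {k m : ℤ} {t : ℝ}
    (h : (m : ℝ) * 2 ^ k ≤ t ∧ t < ((m : ℝ) + 1) * 2 ^ k)
    (hb : b = true ↔ (m : ℝ) * 2 ^ k + 2 ^ (k - 1) ≤ t) :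
    haar1D ε k m t =
      ((2 : ℝ) ^ k) ^ (-(1 / 2 : ℝ)) * if ε then 1 else if b then -1 else 1 := by
  unfold haar1D
  cases ε
  · cases b
    · have : ¬ (m : ℝ) * 2 ^ k + 2 ^ (k - 1) ≤ t := by simpa using hb
      simp [Set.indicator, h.1, this, not_le.1 this]
    · have : (m : ℝ) * 2 ^ k + 2 ^ (k - 1) ≤ t := by simpa using hb
      simp [Set.indicator, h.2, this, not_lt.2 this]
  · simp [Set.indicator, h.1, h.2]

theorem haar1D_of_notMem {ε : Bool} {k m : ℤ} {t : ℝ}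
    (h : ¬ ((m : ℝ) * 2 ^ k ≤ t ∧ t < ((m : ℝ) + 1) * 2 ^ k)) : haar1D ε k m t = 0 := by
  have h2 : (0 : ℝ) < 2 ^ (k - 1) := by positivity
  have e : (2 : ℝ) ^ k = 2 * 2 ^ (k - 1) := by
    rw [← zpow_one_add₀ (by norm_num)]; ring_nf
  unfold haar1D
  cases ε
  · have h1 : ¬ ((m : ℝ) * 2 ^ k ≤ t ∧ t < (m : ℝ) * 2 ^ k + 2 ^ (k - 1)) := fun h' =>
      h ⟨h'.1, by nlinarith [h'.2]⟩
    have h3 : ¬ ((m : ℝ) * 2 ^ k + 2 ^ (k - 1) ≤ t ∧ t < ((m : ℝ) + 1) * 2 ^ k) := fun h' =>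
      h ⟨by nlinarith [h'.1], h'.2⟩
    simp only [Bool.false_eq_true, if_false, Set.indicator, Set.mem_ofPred_eq, h1, h3, sub_self]
  · simp only [if_true, Set.indicator, Set.mem_ofPred_eq, h, if_false]

theorem haarFn_of_mem_child {I : DCube d} {ε b : Fin d → Bool} {x : Fin d → ℝ}
    (h : x ∈ (I.child b).set) : haarFn I ε x = haarScale I * haarSign ε b := by
  obtain ⟨h1, h2⟩ := DCube.mem_child_iff.1 h
  unfold haarFn
  rw [Finset.prod_congr rfl fun i _ => haar1D_of_mem (ε := ε i) (h1 i) (h2 i),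
    Finset.prod_mul_distrib]
  simp [haarScale, haarSign]

theorem haarFn_of_notMem {I : DCube d} {ε : Fin d → Bool} {x : Fin d → ℝ}
    (h : x ∉ I.set) : haarFn I ε x = 0 := by
  have : ∃ i, ¬ ((I.m i : ℝ) * 2 ^ I.k ≤ x i ∧ x i < ((I.m i : ℝ) + 1) * 2 ^ I.k) := by
    by_contra! hc
    exact h fun i => hc i
  obtain ⟨i, hi⟩ := this
  exact Finset.prod_eq_zero (Finset.mem_univ i) (haar1D_of_notMem hi)

theorem haarFn_eq_sum (I : DCube d) (ε : Fin d → Bool) (x : Fin d → ℝ) :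
    haarFn I ε x = ∑ b, (I.child b).set.indicator (fun _ => haarScale I * haarSign ε b) x := by
  by_cases hx : x ∈ I.set
  · have hx' := hx
    rw [← DCube.iUnion_child, Set.mem_iUnion] at hx'
    obtain ⟨b, hb⟩ := hx'
    rw [haarFn_of_mem_child hb, Finset.sum_eq_single b]
    · rw [Set.indicator_of_mem hb]
    · intro b' _ hb'
      exact Set.indicator_of_notMem
        (fun h => Set.disjoint_left.1 (I.pairwise_disjoint_child hb') h hb) _
    · simp
  · rw [haarFn_of_notMem hx]
    exact (Finset.sum_eq_zero fun b _ =>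
      Set.indicator_of_notMem (fun h => hx (I.child_subset b h)) _).symm

variable {F : (Fin d → ℝ) → EuclideanSpace ℂ (Fin n)}

theorem haarFn_smul_eq_sum (I : DCube d) (ε : Fin d → Bool) (x : Fin d → ℝ) :
    haarFn I ε x • F x =
      ∑ b, (I.child b).set.indicator (fun y => (haarScale I * haarSign ε b) • F y) x := by
  rw [haarFn_eq_sum, Finset.sum_smul]
  refine Finset.sum_congr rfl fun b _ => ?_
  by_cases hx : x ∈ (I.child b).set <;> simp [hx]

theorem integrable_haarFn_smul (hF : Integrable F) (I : DCube d) (ε : Fin d → Bool) :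
    Integrable fun x => haarFn I ε x • F x := by
  simp_rw [haarFn_smul_eq_sum]
  exact integrable_finsetSum _ fun b _ =>
    (hF.smul (haarScale I * haarSign ε b)).indicator (DCube.measurableSet_set _)

theorem haarCoef_eq_sum (hF : Integrable F) (I : DCube d) (ε : Fin d → Bool) :
    haarCoef F I ε = haarScale I • ∑ b, haarSign ε b • ∫ x in (I.child b).set, F x := by
  unfold haarCoef
  simp_rw [haarFn_smul_eq_sum]
  rw [integral_finsetSum, Finset.smul_sum]
  swap
  · exact fun b _ =>
      (hF.smul (haarScale I * haarSign ε b)).indicator (DCube.measurableSet_set _)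
  refine Finset.sum_congr rfl fun b _ => ?_
  rw [integral_indicator (DCube.measurableSet_set _), integral_smul, smul_smul]

/-- The average of a vector-valued function over a dyadic cube. -/
def cubeAvg (F : (Fin d → ℝ) → EuclideanSpace ℂ (Fin n)) (I : DCube d) :
    EuclideanSpace ℂ (Fin n) :=
  I.vol⁻¹ • ∫ x in I.set, F x

/-- The average of the norm of a vector-valued function over a dyadic cube. -/
def cubeNormAvg (F : (Fin d → ℝ) → EuclideanSpace ℂ (Fin n)) (I : DCube d) : ℝ≥0∞ :=
  (ENNReal.ofReal I.vol)⁻¹ * ∫⁻ x in I.set, ‖F x‖ₑ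

/-- The energy `|I|⁻¹ ∑_ε |F_I^ε|²` of the Haar coefficients of a cube. -/
def haarEnergy (F : (Fin d → ℝ) → EuclideanSpace ℂ (Fin n)) (I : DCube d) : ℝ≥0∞ :=
  ∑ ε ∈ Sfin d, ENNReal.ofReal (‖haarCoef F I ε‖ ^ 2) / ENNReal.ofReal I.vol

theorem ofReal_vol_ne_zero (I : DCube d) : ENNReal.ofReal I.vol ≠ 0 :=
  (ENNReal.ofReal_pos.2 I.vol_pos).ne'

theorem enorm_cubeAvg_le (F : (Fin d → ℝ) → EuclideanSpace ℂ (Fin n)) (I : DCube d) :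
    ‖cubeAvg F I‖ₑ ≤ cubeNormAvg F I := by
  unfold cubeAvg cubeNormAvg
  rw [enorm_smul, Real.enorm_of_nonneg (inv_nonneg.2 I.vol_pos.le),
    ENNReal.ofReal_inv_of_pos I.vol_pos]
  gcongr
  exact enorm_integral_le_lintegral_enorm _

theorem cubeNormAvg_child_le (F : (Fin d → ℝ) → EuclideanSpace ℂ (Fin n)) (I : DCube d)
    (b : Fin d → Bool) : cubeNormAvg F (I.child b) ≤ 2 ^ d * cubeNormAvg F I := by
  unfold cubeNormAvg
  rw [I.vol_eq_child b, ENNReal.ofReal_mul (by positivity), ENNReal.mul_inv (by simp) (by simp),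
    ENNReal.ofReal_pow (by norm_num), ENNReal.ofReal_ofNat, ← mul_assoc, ← mul_assoc,
    ENNReal.mul_inv_cancel (by simp) (by simp), one_mul]
  gcongr
  exact I.child_subset b

theorem cubeAvg_eq_sum_child (hF : Integrable F) (I : DCube d) :
    (2 ^ d : ℝ) • cubeAvg F I = ∑ b, cubeAvg F (I.child b) := by
  unfold cubeAvg
  rw [I.integral_child hF, Finset.smul_sum, Finset.smul_sum]
  refine Finset.sum_congr rfl fun b _ => ?_
  rw [I.vol_eq_child b, smul_smul, mul_inv, ← mul_assoc, mul_inv_cancel₀ (by positivity), one_mul]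

theorem sum_norm_sub_avg_sq (hF : Integrable F) (I : DCube d) :
    ∑ b, ‖cubeAvg F (I.child b) - cubeAvg F I‖ ^ 2 =
      ∑ b, ‖cubeAvg F (I.child b)‖ ^ 2 - 2 ^ d * ‖cubeAvg F I‖ ^ 2 := by
  simp_rw [norm_sub_sq (𝕜 := ℂ)]
  rw [Finset.sum_add_distrib, Finset.sum_sub_distrib, ← Finset.mul_sum, ← map_sum, ← sum_inner,
    ← cubeAvg_eq_sum_child hF, RCLike.real_smul_eq_coe_smul (K := ℂ), inner_smul_left,
    RCLike.conj_ofReal,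
    RCLike.re_ofReal_mul, inner_self_eq_norm_sq]
  simp
  ring

theorem norm_haarCoef_sq_le (hF : Integrable F) (I : DCube d) {ε : Fin d → Bool}
    (hε : ε ∈ Sfin d) :
    ‖haarCoef F I ε‖ ^ 2 / I.vol ≤
      (2 ^ d)⁻¹ * ∑ b, ‖cubeAvg F (I.child b) - cubeAvg F I‖ ^ 2 := by
  have hv := I.vol_pos
  set w : ℝ := (2 ^ d)⁻¹ * I.vol with hw
  have hwb : ∀ b, (I.child b).vol = w := by
    intro b
    rw [hw, I.vol_eq_child b, ← mul_assoc, inv_mul_cancel₀ (by positivity), one_mul]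
  have hw0 : 0 < w := by positivity
  have h1 : haarCoef F I ε =
      (haarScale I * w) • ∑ b, haarSign ε b • (cubeAvg F (I.child b) - cubeAvg F I) := by
    have : ∀ b, ∫ x in (I.child b).set, F x = w • cubeAvg F (I.child b) := by
      intro b
      rw [cubeAvg, hwb, smul_smul, mul_inv_cancel₀ hw0.ne', one_smul]
    simp_rw [smul_sub, Finset.sum_sub_distrib, ← Finset.sum_smul]
    rw [sum_haarSign hε, zero_smul, sub_zero, haarCoef_eq_sum hF, mul_smul]
    simp_rw [this, Finset.smul_sum, smul_comm _ w]
  have h2 : ‖∑ b, haarSign ε b • (cubeAvg F (I.child b) - cubeAvg F I)‖ ≤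
      ∑ b, ‖cubeAvg F (I.child b) - cubeAvg F I‖ := by
    refine (norm_sum_le _ _).trans (le_of_eq (Finset.sum_congr rfl fun b _ => ?_))
    rw [norm_smul, Real.norm_eq_abs, abs_haarSign, one_mul]
  have h3 := sq_sum_le_card_mul_sum_sq (s := (Finset.univ : Finset (Fin d → Bool)))
    (f := fun b => ‖cubeAvg F (I.child b) - cubeAvg F I‖)
  have hc : ((Finset.univ : Finset (Fin d → Bool)).card : ℝ) = 2 ^ d := by simp
  rw [hc] at h3
  rw [h1, norm_smul, mul_pow, Real.norm_eq_abs, sq_abs, mul_pow, haarScale_sq]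
  have h4 := (pow_le_pow_left₀ (norm_nonneg _) h2 2).trans h3
  calc I.vol⁻¹ * w ^ 2 * _ ^ 2 / I.vol
      ≤ I.vol⁻¹ * w ^ 2 * (2 ^ d * ∑ b, ‖cubeAvg F (I.child b) - cubeAvg F I‖ ^ 2) / I.vol := by
        gcongr
    _ = _ := by
        rw [hw]
        field_simp

theorem card_Sfin_le (d : ℕ) : (Sfin d).card ≤ 2 ^ d := by
  refine (Finset.card_le_univ _).trans ?_
  simp

/-- The energy of a cube is controlled by the increment of the squared averages. -/
theorem haarEnergy_add_le (hF : Integrable F) (I : DCube d) :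
    haarEnergy F I + 2 ^ d * ‖cubeAvg F I‖ₑ ^ 2 ≤ ∑ b, ‖cubeAvg F (I.child b)‖ₑ ^ 2 := by
  have h1 : haarEnergy F I = ENNReal.ofReal (∑ ε ∈ Sfin d, ‖haarCoef F I ε‖ ^ 2 / I.vol) := by
    rw [ENNReal.ofReal_sum_of_nonneg fun ε _ => div_nonneg (sq_nonneg _) I.vol_pos.le]
    exact Finset.sum_congr rfl fun ε _ => (ENNReal.ofReal_div_of_pos I.vol_pos).symm
  have h2 : ∀ J : DCube d, ‖cubeAvg F J‖ₑ ^ 2 = ENNReal.ofReal (‖cubeAvg F J‖ ^ 2) := by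
    intro J
    rw [ENNReal.ofReal_pow (norm_nonneg _), ofReal_norm]
  have h3 : ∑ ε ∈ Sfin d, ‖haarCoef F I ε‖ ^ 2 / I.vol ≤
      ∑ b, ‖cubeAvg F (I.child b) - cubeAvg F I‖ ^ 2 := by
    refine (Finset.sum_le_sum fun ε hε => norm_haarCoef_sq_le hF I hε).trans ?_
    rw [Finset.sum_const, nsmul_eq_mul, ← mul_assoc]
    refine mul_le_of_le_one_left (Finset.sum_nonneg fun _ _ => sq_nonneg _) ?_
    rw [← div_eq_mul_inv, div_le_one (by positivity)]
    exact_mod_cast card_Sfin_le d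
  rw [sum_norm_sub_avg_sq hF] at h3
  simp_rw [h2]
  rw [h1, ← ENNReal.ofReal_sum_of_nonneg fun _ _ => sq_nonneg _,
    show (2 ^ d : ℝ≥0∞) = ENNReal.ofReal (2 ^ d) by
      rw [ENNReal.ofReal_pow (by norm_num), ENNReal.ofReal_ofNat],
    ← ENNReal.ofReal_mul (by positivity), ← ENNReal.ofReal_add
      (Finset.sum_nonneg fun _ _ => div_nonneg (sq_nonneg _) I.vol_pos.le) (by positivity)]
  exact ENNReal.ofReal_le_ofReal (by linarith)

theorem haarEnergy_le (hF : Integrable F) (I : DCube d) :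
    haarEnergy F I ≤ 2 ^ d * cubeNormAvg F I ^ 2 := by
  have hs : ENNReal.ofReal (haarScale I) ^ 2 = (ENNReal.ofReal I.vol)⁻¹ := by
    rw [← ENNReal.ofReal_pow (haarScale_nonneg I), haarScale_sq,
      ENNReal.ofReal_inv_of_pos I.vol_pos]
  have h : ∀ ε ∈ Sfin d,
      ENNReal.ofReal (‖haarCoef F I ε‖ ^ 2) / ENNReal.ofReal I.vol ≤ cubeNormAvg F I ^ 2 := by
    intro ε _
    have h1 : ‖haarCoef F I ε‖ₑ ≤ ENNReal.ofReal (haarScale I) * ∫⁻ x in I.set, ‖F x‖ₑ := by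
      rw [haarCoef_eq_sum hF, enorm_smul, Real.enorm_of_nonneg (haarScale_nonneg I),
        I.lintegral_child]
      gcongr
      refine (enorm_sum_le _ _).trans (Finset.sum_le_sum fun b _ => ?_)
      rw [enorm_smul, Real.enorm_eq_ofReal_abs, abs_haarSign, ENNReal.ofReal_one, one_mul]
      exact enorm_integral_le_lintegral_enorm _
    rw [ENNReal.ofReal_pow (norm_nonneg _), ofReal_norm, cubeNormAvg, mul_pow, div_eq_mul_inv]
    calc _ ≤ (ENNReal.ofReal (haarScale I) * ∫⁻ x in I.set, ‖F x‖ₑ) ^ 2 *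
          (ENNReal.ofReal I.vol)⁻¹ := by gcongr
      _ = _ := by rw [mul_pow, hs]; ring
  unfold haarEnergy
  refine (Finset.sum_le_sum h).trans ?_
  rw [Finset.sum_const, nsmul_eq_mul]
  gcongr
  exact_mod_cast card_Sfin_le d

end HaarEnergy

section DyadicMaximal

variable {d n : ℕ}

open DCube

theorem child_depth {N : ℤ} {t : ℕ} {I : DCube d} (hI : I.k = N - t) (b : Fin d → Bool) :
    (I.child b).k = N - (t + 1 : ℕ) := by
  rw [child_k, hI]; push_cast; ring

/-- If every descendant `J` of `I` with property `B` satisfies `κ μ(J) ≤ ∫_J h`, then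
the union of these descendants does as well, with `∫_I h` on the right. -/
theorem measure_exists_bad_le (μ : Measure (Fin d → ℝ)) (h : (Fin d → ℝ) → ℝ≥0∞) (κ : ℝ≥0∞)
    (B : DCube d → Prop) (N : ℤ) (R t : ℕ) (I : DCube d) (hI : I.k = N - t)
    (hB : ∀ J : DCube d, J.set ⊆ I.set → B J → κ * μ J.set ≤ ∫⁻ x in J.set, h x ∂μ) :
    κ * μ (I.set ∩ {x | ∃ u : ℕ, t < u ∧ u ≤ t + R ∧ B (atPt (N - u) x)}) ≤
      ∫⁻ x in I.set, h x ∂μ := by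
  induction R generalizing t I with
  | zero =>
    have : {x : Fin d → ℝ | ∃ u : ℕ, t < u ∧ u ≤ t + 0 ∧ B (atPt (N - u) x)} = ∅ := by
      ext x
      simp only [Set.mem_ofPred_eq, Set.mem_empty_iff_false, iff_false]
      rintro ⟨u, h1, h2, -⟩
      omega
    rw [this]
    simp
  | succ R ih =>
    rw [measure_inter_child, lintegral_child, Finset.mul_sum]
    refine Finset.sum_le_sum fun b _ => ?_
    by_cases hb : B (I.child b)
    · exact (by gcongr; exact Set.inter_subset_left : _ ≤ κ * μ (I.child b).set).trans
        (hB _ (I.child_subset b) hb)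
    · refine le_trans ?_ (ih (t + 1) (I.child b) (child_depth hI b)
        fun J hJ => hB J (hJ.trans (I.child_subset b)))
      refine mul_le_mul_right (measure_mono ?_) κ
      rintro x ⟨hx, u, h1, h2, h3⟩
      refine ⟨hx, u, ?_, by omega, h3⟩
      rcases Nat.lt_or_ge (t + 1) u with h | h
      · exact h
      · obtain rfl : u = t + 1 := by omega
        rw [atPt_of_mem hx (child_depth hI b)] at h3
        exact absurd h3 hb

variable (F : (Fin d → ℝ) → EuclideanSpace ℂ (Fin n)) (κ : ℝ≥0∞)

/-- The Haar square function, run over `R` generations starting at scale `k` and stopped at the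
first cube where the average of `‖F‖` exceeds `κ`. -/
def stoppedEnergy : ℕ → ℤ → (Fin d → ℝ) → ℝ≥0∞
  | 0, _ => 0
  | R + 1, k => {x | cubeNormAvg F (atPt k x) ≤ κ}.indicator
      fun x => haarEnergy F (atPt k x) + stoppedEnergy R (k - 1) x

theorem measurable_of_dcube (h : DCube d → ℝ≥0∞) (k : ℤ) : Measurable fun x => h (atPt k x) :=
  measurable_of_atPt fun _ _ hxy => by rw [hxy]

theorem measurable_stoppedEnergy (R : ℕ) (k : ℤ) : Measurable (stoppedEnergy F κ R k) := by
  induction R generalizing k with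
  | zero => exact measurable_const
  | succ R ih =>
    have hs : MeasurableSet {x : Fin d → ℝ | cubeNormAvg F (atPt k x) ≤ κ} :=
      measurableSet_le (measurable_of_dcube (cubeNormAvg F) k) measurable_const
    exact ((measurable_of_dcube (haarEnergy F) k).add (ih (k - 1))).indicator hs

variable {F κ}

theorem stoppedEnergy_eq_sum {R : ℕ} {k : ℤ} {x : Fin d → ℝ}
    (h : ∀ j < R, cubeNormAvg F (atPt (k - (j : ℕ)) x) ≤ κ) :
    stoppedEnergy F κ R k x = ∑ j ∈ Finset.range R, haarEnergy F (atPt (k - (j : ℕ)) x) := by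
  induction R generalizing k with
  | zero => simp [stoppedEnergy]
  | succ R ih =>
    have h0 := h 0 (Nat.succ_pos _)
    rw [Nat.cast_zero, sub_zero] at h0
    have h1 : ∀ j < R, cubeNormAvg F (atPt (k - 1 - (j : ℕ)) x) ≤ κ := by
      intro j hj
      have := h (j + 1) (by omega)
      rwa [Nat.cast_add, Nat.cast_one, add_comm (j : ℤ), ← sub_sub] at this
    have h2 : ∀ j : ℕ, k - ((j + 1 : ℕ) : ℤ) = k - 1 - j := fun j => by push_cast; ring
    rw [stoppedEnergy, Set.indicator_of_mem (by exact h0), Finset.sum_range_succ', ih h1, add_comm]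
    simp only [h2, Nat.cast_zero, sub_zero]

theorem lintegral_stoppedEnergy_add_le (hF : Integrable F) (R : ℕ) (I : DCube d)
    (hI : cubeNormAvg F I ≤ 2 ^ d * κ) :
    (∫⁻ x in I.set, stoppedEnergy F κ R I.k x) + 2 ^ d * ‖cubeAvg F I‖ₑ ^ 2 * volume I.set ≤
      2 ^ d * (2 ^ d * κ) ^ 2 * volume I.set := by
  have triv : 2 ^ d * ‖cubeAvg F I‖ₑ ^ 2 * volume I.set ≤
      2 ^ d * (2 ^ d * κ) ^ 2 * volume I.set := by
    gcongr
    exact (enorm_cubeAvg_le F I).trans hI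
  induction R generalizing I with
  | zero => simpa [stoppedEnergy] using triv
  | succ R ih =>
    by_cases hg : cubeNormAvg F I ≤ κ
    · have e1 : ∫⁻ x in I.set, stoppedEnergy F κ (R + 1) I.k x =
          haarEnergy F I * volume I.set +
            ∑ b, ∫⁻ x in (I.child b).set, stoppedEnergy F κ R (I.child b).k x := by
        change _ = _ + ∑ b, ∫⁻ x in (I.child b).set, stoppedEnergy F κ R (I.k - 1) x
        rw [← setLIntegral_const, ← lintegral_child, ← lintegral_add_left measurable_const]
        refine setLIntegral_congr_fun I.measurableSet_set fun x hx => ?_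
        simp only [stoppedEnergy]
        rw [Set.indicator_of_mem (by simpa [mem_set_iff.1 hx] using hg), mem_set_iff.1 hx]
      have hch : ∀ b, cubeNormAvg F (I.child b) ≤ 2 ^ d * κ := fun b =>
        (cubeNormAvg_child_le F I b).trans (by gcongr)
      have hc : ∀ b, volume I.set = 2 ^ d * volume (I.child b).set := by
        intro b
        rw [volume_set, volume_set, I.vol_eq_child b, ENNReal.ofReal_mul (by positivity),
          ENNReal.ofReal_pow (by norm_num), ENNReal.ofReal_ofNat]
      have htr : ∀ b, 2 ^ d * ‖cubeAvg F (I.child b)‖ₑ ^ 2 * volume (I.child b).set ≤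
          2 ^ d * (2 ^ d * κ) ^ 2 * volume (I.child b).set := by
        intro b
        gcongr
        exact (enorm_cubeAvg_le F _).trans (hch b)
      have hsum : ∑ b, volume (I.child b).set = volume I.set := by
        have := I.measure_inter_child volume Set.univ
        simpa using this.symm
      have h2 : haarEnergy F I * volume I.set + 2 ^ d * ‖cubeAvg F I‖ₑ ^ 2 * volume I.set ≤
          ∑ b, 2 ^ d * ‖cubeAvg F (I.child b)‖ₑ ^ 2 * volume (I.child b).set := by
        rw [← add_mul]
        refine (mul_le_mul_left (haarEnergy_add_le hF I) _).trans (le_of_eq ?_)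
        rw [Finset.sum_mul]
        refine Finset.sum_congr rfl fun b _ => ?_
        rw [hc b]
        ring
      rw [e1, add_right_comm]
      refine (add_le_add_left h2 _).trans ?_
      rw [← Finset.sum_add_distrib, ← hsum, Finset.mul_sum]
      refine Finset.sum_le_sum fun b _ => ?_
      rw [add_comm]
      exact ih _ (hch b) (htr b)
    · have e1 : ∫⁻ x in I.set, stoppedEnergy F κ (R + 1) I.k x = 0 := by
        rw [← lintegral_zero (μ := volume.restrict I.set)]
        refine setLIntegral_congr_fun I.measurableSet_set fun x hx => ?_
        simp only [stoppedEnergy]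
        rw [Set.indicator_of_notMem (by simpa [mem_set_iff.1 hx] using hg)]
      rw [e1, zero_add]
      exact triv

end DyadicMaximal

section StoppingProcess

variable {X : Type*} (Bad : ℕ → ℕ → X → Prop)

open Classical in
/-- The last stopping time up to time `t` of the process which, having stopped at time `s`,
stops again at the first time `u > s` with `Bad s u x`. -/
def lastStop : ℕ → X → ℕ
  | 0, _ => 0
  | t + 1, x => if Bad (lastStop t x) (t + 1) x then t + 1 else lastStop t x

theorem lastStop_succ_of_bad {t : ℕ} {x : X} (h : Bad (lastStop Bad t x) (t + 1) x) :
    lastStop Bad (t + 1) x = t + 1 := if_pos h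

theorem lastStop_succ_of_not_bad {t : ℕ} {x : X} (h : ¬Bad (lastStop Bad t x) (t + 1) x) :
    lastStop Bad (t + 1) x = lastStop Bad t x := if_neg h

theorem lastStop_le (t : ℕ) (x : X) : lastStop Bad t x ≤ t := by
  induction t with
  | zero => exact le_rfl
  | succ t ih =>
    by_cases h : Bad (lastStop Bad t x) (t + 1) x
    · rw [lastStop_succ_of_bad Bad h]
    · rw [lastStop_succ_of_not_bad Bad h]
      omega

theorem lastStop_lastStop (t : ℕ) (x : X) :
    lastStop Bad (lastStop Bad t x) x = lastStop Bad t x := by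
  induction t with
  | zero => rfl
  | succ t ih =>
    by_cases h : Bad (lastStop Bad t x) (t + 1) x
    · rw [lastStop_succ_of_bad Bad h, lastStop_succ_of_bad Bad h]
    · rwa [lastStop_succ_of_not_bad Bad h]

theorem not_bad_of_lastStop_lt {t u : ℕ} {x : X} (h1 : lastStop Bad t x < u) (h2 : u ≤ t) :
    ¬Bad (lastStop Bad t x) u x := by
  induction t with
  | zero => omega
  | succ t ih =>
    by_cases h : Bad (lastStop Bad t x) (t + 1) x
    · rw [lastStop_succ_of_bad Bad h] at h1
      omega
    · rw [lastStop_succ_of_not_bad Bad h] at h1 ⊢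
      rcases Nat.lt_or_ge t u with h3 | h3
      · obtain rfl : u = t + 1 := by omega
        exact h
      · exact ih h1 h3

/-- The number of stopping times in `(t, T]`. -/
def stopCount (T t : ℕ) (x : X) : ℕ :=
  ((Finset.Ioc t T).filter fun u => lastStop Bad u x = u).card

/-- The stopping times up to `T`. -/
def stops (T : ℕ) (x : X) : Finset ℕ :=
  (Finset.range (T + 1)).filter fun u => lastStop Bad u x = u

theorem mem_stops {T s : ℕ} {x : X} : s ∈ stops Bad T x ↔ s ≤ T ∧ lastStop Bad s x = s := by
  rw [stops, Finset.mem_filter, Finset.mem_range, Nat.lt_succ_iff]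

theorem stopCount_self (T : ℕ) (x : X) : stopCount Bad T T x = 0 := by
  simp [stopCount]

theorem stopCount_of_lastStop_eq {T t : ℕ} (ht : t < T) {x : X}
    (h : lastStop Bad (t + 1) x = t + 1) :
    stopCount Bad T t x = stopCount Bad T (t + 1) x + 1 := by
  unfold stopCount
  rw [← Finset.insert_Ioc_succ_left_eq_Ioc ht, Finset.filter_insert, Order.succ_eq_add_one,
    if_pos h, Finset.card_insert_of_notMem (by simp)]

theorem stopCount_of_lastStop_ne {T t : ℕ} (ht : t < T) {x : X}
    (h : lastStop Bad (t + 1) x ≠ t + 1) :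
    stopCount Bad T t x = stopCount Bad T (t + 1) x := by
  unfold stopCount
  rw [← Finset.insert_Ioc_succ_left_eq_Ioc ht, Finset.filter_insert, Order.succ_eq_add_one,
    if_neg h]

theorem stopCount_lt {T s t : ℕ} (hst : s < t) (htT : t ≤ T) {x : X}
    (h : lastStop Bad t x = t) : stopCount Bad T t x < stopCount Bad T s x := by
  unfold stopCount
  refine Finset.card_lt_card (Finset.ssubset_iff_of_subset ?_ |>.2 ⟨t, ?_, ?_⟩)
  · exact Finset.filter_subset_filter _ (Finset.Ioc_subset_Ioc_left hst.le)
  · simp [hst, htT, h]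
  · simp

theorem sum_pow_stopCount_le (T : ℕ) (x : X) (ρ : ℝ≥0∞) :
    ∑ s ∈ stops Bad T x, ρ ^ stopCount Bad T s x ≤ (1 - ρ)⁻¹ := by
  have hinj : Set.InjOn (fun s => stopCount Bad T s x) (stops Bad T x) := by
    intro s hs t ht hst
    have hs' := (mem_stops Bad).1 (Finset.mem_coe.1 hs)
    have ht' := (mem_stops Bad).1 (Finset.mem_coe.1 ht)
    rcases lt_trichotomy s t with h | h | h
    · exact absurd hst (stopCount_lt Bad h ht'.1 ht'.2).ne'
    · exact h
    · exact absurd hst (stopCount_lt Bad h hs'.1 hs'.2).ne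
  rw [← Finset.sum_image (f := fun k => ρ ^ k) hinj, ← ENNReal.tsum_geometric]
  exact ENNReal.sum_le_tsum _

/-- If the energy between consecutive stopping times is at most `(c a_s)²`, then the square root
of the total energy is at most `c ∑_s a_s`. -/
theorem sqrt_sum_le_sum_stops (T : ℕ) (x : X) (e a : ℕ → ℝ≥0∞) (c : ℝ≥0∞)
    (h : ∀ s t, s ≤ t → t ≤ T → (∀ u, s < u → u ≤ t → ¬Bad s u x) →
      ∑ v ∈ Finset.Icc s t, e v ≤ (c * a s) ^ 2) :
    (∑ v ∈ Finset.range (T + 1), e v) ^ (1 / 2 : ℝ) ≤ c * ∑ s ∈ stops Bad T x, a s := by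
  have hmaps : ∀ v ∈ Finset.range (T + 1), lastStop Bad v x ∈ stops Bad T x := by
    intro v hv
    rw [mem_stops]
    exact ⟨(lastStop_le Bad v x).trans (Nat.lt_succ_iff.1 (Finset.mem_range.1 hv)),
      lastStop_lastStop Bad v x⟩
  have hsub : ∀ (S : Finset ℕ) (g : ℕ → ℝ≥0∞),
      (∑ s ∈ S, g s) ^ (1 / 2 : ℝ) ≤ ∑ s ∈ S, g s ^ (1 / 2 : ℝ) := by
    intro S g
    induction S using Finset.cons_induction with
    | empty => simp
    | cons s S hs ih =>
      rw [Finset.sum_cons, Finset.sum_cons]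
      exact (ENNReal.rpow_add_le_add_rpow _ _ (by norm_num) (by norm_num)).trans
        (add_le_add_right ih _)
  rw [← Finset.sum_fiberwise_of_maps_to hmaps, Finset.mul_sum]
  refine (hsub _ _).trans (Finset.sum_le_sum fun s hs => ?_)
  set A := (Finset.range (T + 1)).filter fun v => lastStop Bad v x = s with hA
  have hs' := (mem_stops Bad).1 hs
  have hne : A.Nonempty := ⟨s, by simp [hA, hs'.2]; omega⟩
  have hmax := Finset.mem_filter.1 (Finset.max'_mem A hne)
  have hmaxT := Finset.mem_range.1 hmax.1
  have hle : s ≤ A.max' hne := hmax.2 ▸ lastStop_le Bad _ x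
  have hle : ∑ v ∈ A, e v ≤ (c * a s) ^ 2 := by
    refine le_trans (Finset.sum_le_sum_of_subset ?_) (h s (A.max' hne) hle (by omega) ?_)
    · intro v hv
      refine Finset.mem_Icc.2 ⟨?_, Finset.le_max' A v hv⟩
      rw [hA, Finset.mem_filter] at hv
      exact hv.2 ▸ lastStop_le Bad _ x
    · intro u h1 h2
      have := not_bad_of_lastStop_lt Bad (t := A.max' hne) (u := u) (x := x)
        (by rw [hmax.2]; exact h1) h2
      rwa [hmax.2] at this
  calc (∑ v ∈ A, e v) ^ (1 / 2 : ℝ) ≤ ((c * a s) ^ 2) ^ (1 / 2 : ℝ) := by gcongr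
    _ = c * a s := by
      rw [← ENNReal.rpow_natCast, ← ENNReal.rpow_mul]
      norm_num

end StoppingProcess

section DyadicStopping

open DCube

variable {d : ℕ} {Bad : ℕ → ℕ → (Fin d → ℝ) → Prop} {N : ℤ}

/-- `Bad s t x` depends only on the dyadic cube of side `2 ^ (N - t)` containing `x`. -/
def IsLocal (N : ℤ) (Bad : ℕ → ℕ → (Fin d → ℝ) → Prop) : Prop :=
  ∀ ⦃s t : ℕ⦄, s ≤ t → ∀ ⦃x y⦄, atPt (N - t) x = atPt (N - t) y → (Bad s t x ↔ Bad s t y)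

theorem atPt_eq_of_depth_le {s t : ℕ} (hst : s ≤ t) {x y : Fin d → ℝ}
    (h : atPt (N - t) x = atPt (N - t) y) : atPt (N - s) x = atPt (N - s) y :=
  atPt_eq_of_le (by omega) h

theorem IsLocal.lastStop_congr (hB : IsLocal N Bad) {t : ℕ} {x y : Fin d → ℝ}
    (h : atPt (N - t) x = atPt (N - t) y) : lastStop Bad t x = lastStop Bad t y := by
  induction t with
  | zero => rfl
  | succ t ih =>
    have ih' := ih (atPt_eq_of_depth_le (Nat.le_succ t) h)
    have hb := hB ((lastStop_le Bad t x).trans (Nat.le_succ t)) h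
    by_cases hx : Bad (lastStop Bad t x) (t + 1) x
    · rw [lastStop_succ_of_bad Bad hx, lastStop_succ_of_bad Bad (ih' ▸ hb.1 hx)]
    · rw [lastStop_succ_of_not_bad Bad hx, lastStop_succ_of_not_bad Bad, ih']
      rw [← ih', ← hb]
      exact hx

theorem IsLocal.stopCount_congr (hB : IsLocal N Bad) {T t : ℕ} {x y : Fin d → ℝ}
    (h : atPt (N - T) x = atPt (N - T) y) : stopCount Bad T t x = stopCount Bad T t y := by
  unfold stopCount
  congr 1
  refine Finset.filter_congr fun u hu => ?_
  rw [hB.lastStop_congr (atPt_eq_of_depth_le (Finset.mem_Ioc.1 hu).2 h)]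

theorem IsLocal.measurable_stopCount (hB : IsLocal N Bad) (T t : ℕ) :
    Measurable (stopCount Bad T t) :=
  measurable_of_atPt fun _ _ h => hB.stopCount_congr h

theorem IsLocal.measurableSet_bad (hB : IsLocal N Bad) {s t T : ℕ} (hst : s ≤ t) :
    MeasurableSet {x | ∃ u, t < u ∧ u ≤ T ∧ Bad s u x} := by
  refine measurableSet_of_atPt (k := N - T) fun x y h => ?_
  refine exists_congr fun u => and_congr_right fun h1 => and_congr_right fun h2 => ?_
  exact hB (hst.trans h1.le) (atPt_eq_of_depth_le h2 h)

variable {μ : Measure (Fin d → ℝ)} {δ : ℝ≥0∞} {T : ℕ}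

/-- Every cube retains a proportion `δ` of its `μ`-mass outside of its bad descendants. -/
def RetainsMass (N : ℤ) (T : ℕ) (Bad : ℕ → ℕ → (Fin d → ℝ) → Prop) (μ : Measure (Fin d → ℝ))
    (δ : ℝ≥0∞) : Prop :=
  ∀ s ≤ T, ∀ L : DCube d, L.k = N - s →
    δ * μ L.set + μ (L.set ∩ {x | ∃ u, s < u ∧ u ≤ T ∧ Bad s u x}) ≤ μ L.set

theorem lintegral_pow_stopCount_aux (hB : IsLocal N Bad) (H : RetainsMass N T Bad μ δ)
    {t : ℕ} (ht : t ≤ T) {s : ℕ} (hst : s ≤ t) (I : DCube d) (hI : I.k = N - t)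
    (hs : ∀ x ∈ I.set, lastStop Bad t x = s) :
    δ * ∫⁻ x in I.set, (1 + δ) ^ stopCount Bad T t x ∂μ ≤
      δ * μ I.set + μ (I.set ∩ {x | ∃ u, t < u ∧ u ≤ T ∧ Bad s u x}) := by
  induction ht using Nat.decreasingInduction generalizing s I with
  | self => simp [stopCount_self]
  | of_succ t htT ih =>
    have hsum : μ I.set = ∑ b, μ (I.child b).set := by
      simpa using I.measure_inter_child μ Set.univ
    rw [lintegral_child, measure_inter_child, hsum, Finset.mul_sum, Finset.mul_sum,
      ← Finset.sum_add_distrib]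
    refine Finset.sum_le_sum fun b _ => ?_
    have hk := child_depth hI b
    have hcong : ∀ x ∈ (I.child b).set, ∀ y ∈ (I.child b).set,
        atPt (N - (t + 1 : ℕ)) x = atPt (N - (t + 1 : ℕ)) y := by
      intro x hx y hy
      rw [atPt_of_mem hx hk, atPt_of_mem hy hk]
    by_cases hbad : ∃ y ∈ (I.child b).set, Bad s (t + 1) y
    · obtain ⟨y, hy, hy'⟩ := hbad
      have hall : ∀ x ∈ (I.child b).set, Bad s (t + 1) x := fun x hx =>
        (hB (hst.trans (Nat.le_succ t)) (hcong x hx y hy)).2 hy'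
      have hlast : ∀ x ∈ (I.child b).set, lastStop Bad (t + 1) x = t + 1 := fun x hx =>
        lastStop_succ_of_bad Bad (by rw [hs x (I.child_subset b hx)]; exact hall x hx)
      have e1 : ∫⁻ x in (I.child b).set, (1 + δ) ^ stopCount Bad T t x ∂μ =
          (1 + δ) * ∫⁻ x in (I.child b).set, (1 + δ) ^ stopCount Bad T (t + 1) x ∂μ := by
        rw [← lintegral_const_mul _
          (measurable_of_atPt (k := N - T) fun x y h => by rw [hB.stopCount_congr h])]
        refine setLIntegral_congr_fun (measurableSet_set _) fun x hx => ?_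
        rw [stopCount_of_lastStop_eq Bad htT (hlast x hx), pow_succ, mul_comm]
      have e2 : (I.child b).set ∩ {x | ∃ u, t < u ∧ u ≤ T ∧ Bad s u x} = (I.child b).set := by
        refine Set.inter_eq_left.2 fun x hx => ⟨t + 1, Nat.lt_succ_self t, htT, hall x hx⟩
      rw [e1, e2, mul_left_comm]
      refine (mul_le_mul_right ((ih le_rfl _ hk hlast).trans (H (t + 1) htT _ hk)) _).trans ?_
      rw [add_mul, one_mul, add_comm]
    · push Not at hbad
      have hlast : ∀ x ∈ (I.child b).set, lastStop Bad (t + 1) x = s := fun x hx => by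
        have := hs x (I.child_subset b hx)
        rw [lastStop_succ_of_not_bad Bad (by rw [this]; exact hbad x hx), this]
      have e1 : ∫⁻ x in (I.child b).set, (1 + δ) ^ stopCount Bad T t x ∂μ =
          ∫⁻ x in (I.child b).set, (1 + δ) ^ stopCount Bad T (t + 1) x ∂μ := by
        refine setLIntegral_congr_fun (measurableSet_set _) fun x hx => ?_
        rw [stopCount_of_lastStop_ne Bad htT]
        rw [hlast x hx]
        omega
      rw [e1]
      refine (ih (hst.trans (Nat.le_succ t)) _ hk hlast).trans ?_
      refine add_le_add_right (measure_mono ?_) _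
      rintro x ⟨hx, u, h1, h2⟩
      exact ⟨hx, u, by omega, h2⟩

/-- The number of stopping times is exponentially integrable over a stopping cube. -/
theorem lintegral_pow_stopCount_le (hB : IsLocal N Bad) (H : RetainsMass N T Bad μ δ)
    {s : ℕ} (hs : s ≤ T) (L : DCube d) (hL : L.k = N - s)
    (hlast : ∀ x ∈ L.set, lastStop Bad s x = s) :
    δ * ∫⁻ x in L.set, (1 + δ) ^ stopCount Bad T s x ∂μ ≤ μ L.set :=
  (lintegral_pow_stopCount_aux hB H hs le_rfl L hL hlast).trans (H s hs L hL)

end DyadicStopping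

section StoppingSum

open DCube

/-- Hölder's inequality for a finite sum with geometric weights. -/
theorem rpow_sum_le_sum_mul_pow {p : ℝ} (hp : 1 < p) {r : ℝ≥0∞} (hr0 : r ≠ 0) (hr : r ≠ ⊤)
    (S : Finset ℕ) (a : ℕ → ℝ≥0∞) (k : ℕ → ℕ) :
    (∑ s ∈ S, a s) ^ (p / (p - 1)) ≤
      (∑ s ∈ S, a s ^ (p / (p - 1)) * r ^ k s) *
        (∑ s ∈ S, (r ^ (-(p - 1))) ^ k s) ^ (1 / (p - 1)) := by
  have hp1 : 0 < p - 1 := by linarith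
  have hpq : (p / (p - 1)).HolderConjugate p := (Real.HolderConjugate.conjExponent hp).symm
  have hq : 0 < p / (p - 1) := by positivity
  have h := ENNReal.inner_le_Lp_mul_Lq S (fun s => a s * r ^ ((k s : ℝ) * ((p - 1) / p)))
    (fun s => r ^ (-((k s : ℝ) * ((p - 1) / p)))) hpq
  have e1 : ∀ s, a s * r ^ ((k s : ℝ) * ((p - 1) / p)) * r ^ (-((k s : ℝ) * ((p - 1) / p))) =
      a s := by
    intro s
    rw [mul_assoc, ← ENNReal.rpow_add _ _ hr0 hr, add_neg_cancel, ENNReal.rpow_zero, mul_one]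
  have e2 : ∀ s, (a s * r ^ ((k s : ℝ) * ((p - 1) / p))) ^ (p / (p - 1)) =
      a s ^ (p / (p - 1)) * r ^ k s := by
    intro s
    rw [ENNReal.mul_rpow_of_nonneg _ _ hq.le, ← ENNReal.rpow_mul, ← ENNReal.rpow_natCast]
    congr 2
    field_simp
  have e3 : ∀ s, (r ^ (-((k s : ℝ) * ((p - 1) / p)))) ^ p = (r ^ (-(p - 1))) ^ k s := by
    intro s
    rw [← ENNReal.rpow_mul, ← ENNReal.rpow_natCast, ← ENNReal.rpow_mul]
    congr 1
    field_simp
  simp only [e1, e2, e3] at h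
  refine (ENNReal.rpow_le_rpow h hq.le).trans (le_of_eq ?_)
  rw [ENNReal.mul_rpow_of_nonneg _ _ hq.le, ← ENNReal.rpow_mul, ← ENNReal.rpow_mul]
  congr 2
  · rw [one_div_mul_cancel hq.ne', ENNReal.rpow_one]
  · field_simp

theorem rpow_neg_lt_one {r : ℝ≥0∞} (hr : 1 < r) {z : ℝ} (hz : 0 < z) : r ^ (-z) < 1 :=
  ENNReal.rpow_lt_one_of_one_lt_of_neg hr (by linarith)

variable {d : ℕ} {Bad : ℕ → ℕ → (Fin d → ℝ) → Prop} {N : ℤ} {T : ℕ}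

/-- The constant in the summation over stopping cubes. -/
def stopConst (p : ℝ) : ℝ≥0∞ := 2 * (1 - (1 + 2⁻¹ : ℝ≥0∞) ^ (-(p - 1)))⁻¹ ^ (1 / (p - 1))

theorem stopConst_lt_top {p : ℝ} (hp : 1 < p) : stopConst p < ⊤ := by
  refine ENNReal.mul_lt_top (by simp) (ENNReal.rpow_lt_top_of_nonneg
    (by rw [one_div, inv_nonneg]; linarith) ?_)
  rw [Ne, ENNReal.inv_eq_top, tsub_eq_zero_iff_le, not_le]
  refine rpow_neg_lt_one ?_ (by linarith)
  exact ENNReal.lt_add_right (by simp) (by simp)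

theorem sum_stops_eq_sum_indicator (T : ℕ) (x : Fin d → ℝ) (g : ℕ → (Fin d → ℝ) → ℝ≥0∞) :
    ∑ s ∈ stops Bad T x, g s x =
      ∑ s ∈ Finset.range (T + 1), {y | lastStop Bad s y = s}.indicator (g s) x := by
  rw [stops, Finset.sum_filter]
  refine Finset.sum_congr rfl fun s _ => ?_
  by_cases h : lastStop Bad s x = s <;> simp [h]

theorem IsLocal.measurableSet_lastStop (hB : IsLocal N Bad) (s : ℕ) :
    MeasurableSet {y | lastStop Bad s y = s} :=
  measurableSet_of_atPt (k := N - s) fun x y h => by rw [hB.lastStop_congr h]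

/-- Comparison of integrals over the union of the stopping cubes of one generation. -/
theorem lintegral_indicator_stop_le (hB : IsLocal N Bad) (s : ℕ) (g h : (Fin d → ℝ) → ℝ≥0∞)
    (H : ∀ L : DCube d, L.k = N - s → (∀ x ∈ L.set, lastStop Bad s x = s) →
      ∫⁻ x in L.set, g x ≤ ∫⁻ x in L.set, h x) :
    ∫⁻ x, {y | lastStop Bad s y = s}.indicator g x ≤
      ∫⁻ x, {y | lastStop Bad s y = s}.indicator h x := by
  refine lintegral_le_of_cubes (N - s) _ _ fun I hI => ?_
  have hcong : ∀ x ∈ I.set, ∀ y ∈ I.set, lastStop Bad s x = lastStop Bad s y := fun x hx y hy =>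
    hB.lastStop_congr (by rw [atPt_of_mem hx hI, atPt_of_mem hy hI])
  by_cases hs : ∃ y ∈ I.set, lastStop Bad s y = s
  · obtain ⟨y, hy, hys⟩ := hs
    have hall : ∀ x ∈ I.set, lastStop Bad s x = s := fun x hx => (hcong x hx y hy).trans hys
    have e : ∀ g : (Fin d → ℝ) → ℝ≥0∞,
        ∫⁻ x in I.set, {y | lastStop Bad s y = s}.indicator g x = ∫⁻ x in I.set, g x := fun g =>
      setLIntegral_congr_fun I.measurableSet_set fun x hx =>
        Set.indicator_of_mem (by exact hall x hx) g
    rw [e, e]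
    exact H I hI hall
  · push Not at hs
    have e : ∫⁻ x in I.set, {y | lastStop Bad s y = s}.indicator g x = 0 := by
      rw [← lintegral_zero (μ := volume.restrict I.set)]
      exact setLIntegral_congr_fun I.measurableSet_set fun x hx =>
        Set.indicator_of_notMem (by exact hs x hx) g
    rw [e]
    exact zero_le

theorem lintegral_sum_stops_rpow_le {p : ℝ} (hp : 1 < p) (hB : IsLocal N Bad)
    (H : RetainsMass N T Bad volume 2⁻¹) (a : ℕ → (Fin d → ℝ) → ℝ≥0∞)
    (ha : ∀ (s : ℕ) x y, atPt (N - s) x = atPt (N - s) y → a s x = a s y)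
    (G : (Fin d → ℝ) → ℝ≥0∞) (hG : AEMeasurable G) (c ρ : ℝ≥0∞)
    (hL : ∀ s ≤ T, ∀ L : DCube d, L.k = N - s → (∀ x ∈ L.set, lastStop Bad s x = s) →
      ∀ y ∈ L.set, a s y ^ (p / (p - 1)) * volume L.set ≤
        c * ∫⁻ x in L.set, G x * ρ ^ stopCount Bad T s x) :
    ∫⁻ x, (∑ s ∈ stops Bad T x, a s x) ^ (p / (p - 1)) ≤
      stopConst p * c * (1 - ρ)⁻¹ * ∫⁻ x, G x := by
  have hp1 : 0 < p - 1 := by linarith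
  set q := p / (p - 1) with hq
  have hmN : ∀ (r : ℝ≥0∞) s, Measurable fun x => r ^ stopCount Bad T s x := fun r s =>
    measurable_of_atPt (k := N - T) fun x y h => by rw [hB.stopCount_congr h]
  have hmG : ∀ s, AEMeasurable fun x => G x * ρ ^ stopCount Bad T s x := fun s =>
    hG.mul (hmN ρ s).aemeasurable
  have hma : ∀ s, Measurable fun x => a s x ^ q := fun s =>
    (measurable_of_atPt (ha s)).pow_const q
  set D : ℝ≥0∞ := (1 - (1 + 2⁻¹ : ℝ≥0∞) ^ (-(p - 1)))⁻¹ ^ (1 / (p - 1)) with hD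
  have h1 : ∀ x, (∑ s ∈ stops Bad T x, a s x) ^ q ≤
      D * ∑ s ∈ Finset.range (T + 1), {y | lastStop Bad s y = s}.indicator
        (fun x => a s x ^ q * (1 + 2⁻¹) ^ stopCount Bad T s x) x := by
    intro x
    rw [← sum_stops_eq_sum_indicator T x fun s x => a s x ^ q * (1 + 2⁻¹) ^ stopCount Bad T s x,
      mul_comm]
    refine (rpow_sum_le_sum_mul_pow hp (r := 1 + 2⁻¹) (by simp) (by simp) _ _
      fun s => stopCount Bad T s x).trans (mul_le_mul_right ?_ _)
    exact ENNReal.rpow_le_rpow (sum_pow_stopCount_le Bad T x _) (by positivity)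
  have h2 : ∀ s ∈ Finset.range (T + 1), ∫⁻ x, {y | lastStop Bad s y = s}.indicator
        (fun x => a s x ^ q * (1 + 2⁻¹) ^ stopCount Bad T s x) x ≤
      2 * c * ∫⁻ x, {y | lastStop Bad s y = s}.indicator
        (fun x => G x * ρ ^ stopCount Bad T s x) x := by
    intro s hs
    have hsT : s ≤ T := Nat.lt_succ_iff.1 (Finset.mem_range.1 hs)
    rw [← lintegral_const_mul'' _ ((hmG s).indicator (hB.measurableSet_lastStop s))]
    have e : ∀ x, 2 * c * {y | lastStop Bad s y = s}.indicator
        (fun x => G x * ρ ^ stopCount Bad T s x) x = {y | lastStop Bad s y = s}.indicator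
        (fun x => 2 * c * (G x * ρ ^ stopCount Bad T s x)) x := by
      intro x
      by_cases h : lastStop Bad s x = s <;> simp [h]
    simp_rw [e]
    refine lintegral_indicator_stop_le hB s _ _ fun L hLk hlast => ?_
    rw [lintegral_const_mul'' _ (hmG s).restrict]
    rcases L.set.eq_empty_or_nonempty with h | ⟨y, hy⟩
    · simp [h]
    have e2 : ∫⁻ x in L.set, a s x ^ q * (1 + 2⁻¹) ^ stopCount Bad T s x =
        a s y ^ q * ∫⁻ x in L.set, (1 + 2⁻¹) ^ stopCount Bad T s x := by
      rw [← lintegral_const_mul _ (hmN _ s)]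
      refine setLIntegral_congr_fun L.measurableSet_set fun x hx => ?_
      rw [ha s x y (by rw [atPt_of_mem hx hLk, atPt_of_mem hy hLk])]
    have h3 : ∫⁻ x in L.set, (1 + 2⁻¹) ^ stopCount Bad T s x ≤ 2 * volume L.set := by
      have := lintegral_pow_stopCount_le hB H hsT L hLk hlast
      calc _ = 2 * (2⁻¹ * ∫⁻ x in L.set, (1 + 2⁻¹) ^ stopCount Bad T s x) := by
            rw [← mul_assoc, ENNReal.mul_inv_cancel (by simp) (by simp), one_mul]
        _ ≤ _ := by gcongr
    rw [e2]
    calc _ ≤ a s y ^ q * (2 * volume L.set) := by gcongr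
      _ = 2 * (a s y ^ q * volume L.set) := by ring
      _ ≤ 2 * (c * ∫⁻ x in L.set, G x * ρ ^ stopCount Bad T s x) :=
        mul_le_mul_right (hL s hsT L hLk hlast y hy) _
      _ = _ := by ring
  calc ∫⁻ x, (∑ s ∈ stops Bad T x, a s x) ^ q
      ≤ ∫⁻ x, D * ∑ s ∈ Finset.range (T + 1), {y | lastStop Bad s y = s}.indicator
        (fun x => a s x ^ q * (1 + 2⁻¹) ^ stopCount Bad T s x) x := lintegral_mono h1
    _ = D * ∑ s ∈ Finset.range (T + 1), ∫⁻ x, {y | lastStop Bad s y = s}.indicator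
        (fun x => a s x ^ q * (1 + 2⁻¹) ^ stopCount Bad T s x) x := by
      have hm : ∀ s ∈ Finset.range (T + 1), Measurable ({y | lastStop Bad s y = s}.indicator
          fun x => a s x ^ q * (1 + 2⁻¹) ^ stopCount Bad T s x) := fun s _ =>
        ((hma s).mul (hmN _ s)).indicator (hB.measurableSet_lastStop s)
      rw [lintegral_const_mul _ (Finset.measurable_fun_sum _ hm), lintegral_finsetSum _ hm]
    _ ≤ D * ∑ s ∈ Finset.range (T + 1), 2 * c * ∫⁻ x, {y | lastStop Bad s y = s}.indicator
        (fun x => G x * ρ ^ stopCount Bad T s x) x := by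
      gcongr with s hs
      exact h2 s hs
    _ = D * (2 * c) * ∫⁻ x, ∑ s ∈ Finset.range (T + 1), {y | lastStop Bad s y = s}.indicator
        (fun x => G x * ρ ^ stopCount Bad T s x) x := by
      rw [← Finset.mul_sum, lintegral_finsetSum' _ fun s _ =>
        (hmG s).indicator (hB.measurableSet_lastStop s)]
      ring
    _ ≤ D * (2 * c) * ∫⁻ x, (1 - ρ)⁻¹ * G x := by
      gcongr with x
      rw [← sum_stops_eq_sum_indicator T x fun s x => G x * ρ ^ stopCount Bad T s x,
        ← Finset.mul_sum, mul_comm]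
      gcongr
      exact sum_pow_stopCount_le Bad T x ρ
    _ = _ := by
      rw [lintegral_const_mul'' _ hG, stopConst, ← hD]
      ring

end StoppingSum

section MatrixApp

variable {n : ℕ}

theorem mApp_mul (M N : Matrix (Fin n) (Fin n) ℂ) (v : EuclideanSpace ℂ (Fin n)) :
    mApp (M * N) v = mApp M (mApp N v) := by
  simp [mApp]

theorem mApp_one (v : EuclideanSpace ℂ (Fin n)) : mApp 1 v = v := by
  simp [mApp]

theorem norm_mApp_le (M : Matrix (Fin n) (Fin n) ℂ) (v : EuclideanSpace ℂ (Fin n)) :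
    ‖mApp M v‖ ≤ matNorm M * ‖v‖ :=
  ContinuousLinearMap.le_opNorm _ _

theorem matNorm_nonneg (M : Matrix (Fin n) (Fin n) ℂ) : 0 ≤ matNorm M := norm_nonneg _

theorem matNorm_conjTranspose (M : Matrix (Fin n) (Fin n) ℂ) :
    matNorm M.conjTranspose = matNorm M := by
  unfold matNorm
  rw [← Matrix.star_eq_conjTranspose, map_star, ContinuousLinearMap.star_eq_adjoint,
    LinearIsometryEquiv.norm_map]

theorem matNorm_mul_comm {M N : Matrix (Fin n) (Fin n) ℂ} (hM : M.IsHermitian)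
    (hN : N.IsHermitian) : matNorm (M * N) = matNorm (N * M) := by
  rw [← matNorm_conjTranspose, Matrix.conjTranspose_mul, hM.eq, hN.eq]

/-- The standard basis of `ℂⁿ`. -/
def stdVec (i : Fin n) : EuclideanSpace ℂ (Fin n) := EuclideanSpace.single i 1

@[simp] theorem norm_stdVec (i : Fin n) : ‖stdVec i‖ = 1 := by simp [stdVec]

theorem matNorm_le_sum (M : Matrix (Fin n) (Fin n) ℂ) :
    matNorm M ≤ ∑ i, ‖mApp M (stdVec i)‖ := by
  refine ContinuousLinearMap.opNorm_le_bound _ (Finset.sum_nonneg fun _ _ => norm_nonneg _)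
    fun v => ?_
  have hv : v = ∑ i, v i • stdVec i := by
    conv_lhs => rw [← (EuclideanSpace.basisFun (Fin n) ℂ).sum_repr v]
    simp [stdVec]
  conv_lhs => rw [hv, map_sum]
  rw [Finset.sum_mul]
  refine (norm_sum_le _ _).trans (Finset.sum_le_sum fun i _ => ?_)
  rw [map_smul, norm_smul, mul_comm]
  exact mul_le_mul_of_nonneg_left (PiLp.norm_apply_le v i) (norm_nonneg _)

theorem norm_mApp_le_sum (M : Matrix (Fin n) (Fin n) ℂ) (v : EuclideanSpace ℂ (Fin n)) :
    ‖mApp M v‖ ≤ (∑ i, ‖mApp M (stdVec i)‖) * ‖v‖ :=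
  (norm_mApp_le M v).trans (mul_le_mul_of_nonneg_right (matNorm_le_sum M) (norm_nonneg _))

theorem norm_mApp_mul_le_sum {M N : Matrix (Fin n) (Fin n) ℂ} (hM : M.IsHermitian)
    (hN : N.IsHermitian) (v : EuclideanSpace ℂ (Fin n)) :
    ‖mApp (M * N) v‖ ≤ (∑ i, ‖mApp (N * M) (stdVec i)‖) * ‖v‖ := by
  refine (norm_mApp_le _ v).trans (mul_le_mul_of_nonneg_right ?_ (norm_nonneg _))
  rw [matNorm_mul_comm hM hN]
  exact matNorm_le_sum _

theorem inner_mApp_left {M : Matrix (Fin n) (Fin n) ℂ} (hM : M.IsHermitian)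
    (u v : EuclideanSpace ℂ (Fin n)) : inner ℂ (mApp M u) v = inner ℂ u (mApp M v) := by
  unfold mApp
  conv_lhs => rw [← hM.eq, ← Matrix.star_eq_conjTranspose, map_star]
  exact ContinuousLinearMap.adjoint_inner_left _ _ _

theorem mApp_inv_mApp {M : Matrix (Fin n) (Fin n) ℂ} (hM : M.PosDef)
    (v : EuclideanSpace ℂ (Fin n)) : mApp M⁻¹ (mApp M v) = v := by
  rw [← mApp_mul, Matrix.nonsing_inv_mul _ ((Matrix.isUnit_iff_isUnit_det _).1 hM.isUnit),
    mApp_one]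

theorem mApp_mApp_inv {M : Matrix (Fin n) (Fin n) ℂ} (hM : M.PosDef)
    (v : EuclideanSpace ℂ (Fin n)) : mApp M (mApp M⁻¹ v) = v := by
  rw [← mApp_mul, Matrix.mul_nonsing_inv _ ((Matrix.isUnit_iff_isUnit_det _).1 hM.isUnit),
    mApp_one]

theorem mApp_haarCoef {d : ℕ} (M : Matrix (Fin n) (Fin n) ℂ)
    {f : (Fin d → ℝ) → EuclideanSpace ℂ (Fin n)} (hf : Integrable f) (I : DCube d)
    (ε : Fin d → Bool) : mApp M (haarCoef f I ε) = haarCoef (fun x => mApp M (f x)) I ε := by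
  unfold mApp haarCoef
  rw [← ContinuousLinearMap.integral_comp_comm _ (integrable_haarFn_smul hf I ε)]
  simp

end MatrixApp

section MatrixMeasurability

variable {d n : ℕ} {X : Type*} [MeasurableSpace X]

theorem continuous_toEuclideanCLM :
    Continuous fun M : Matrix (Fin n) (Fin n) ℂ =>
      Matrix.toEuclideanCLM (𝕜 := ℂ) (n := Fin n) M :=
  LinearMap.continuous_of_finiteDimensional
    (Matrix.toEuclideanCLM (𝕜 := ℂ) (n := Fin n)).toAlgEquiv.toLinearMap

theorem measurable_continuous_comp {Y : Type*} [TopologicalSpace Y] [MeasurableSpace Y]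
    [BorelSpace Y] {M : X → Matrix (Fin n) (Fin n) ℂ} (hM : ∀ i j, Measurable fun x => M x i j)
    {Φ : Matrix (Fin n) (Fin n) ℂ → Y} (hΦ : Continuous Φ) : Measurable fun x => Φ (M x) := by
  have hM' : Measurable (β := Fin n → Fin n → ℂ) M :=
    measurable_pi_iff.2 fun i => measurable_pi_iff.2 fun j => hM i j
  have hΦ' : Continuous (X := Fin n → Fin n → ℂ) Φ := hΦ
  exact hΦ'.measurable.comp hM'

theorem measurable_inv_apply {M : X → Matrix (Fin n) (Fin n) ℂ}
    (hM : ∀ i j, Measurable fun x => M x i j) (i j : Fin n) :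
    Measurable fun x => (M x)⁻¹ i j := by
  have h1 : Measurable fun x => (M x).det :=
    measurable_continuous_comp hM (Continuous.matrix_det continuous_id)
  have h2 : Measurable fun x => (M x).adjugate i j :=
    measurable_continuous_comp hM
      ((Continuous.matrix_adjugate continuous_id).matrix_elem i j)
  simp only [Matrix.inv_def, Ring.inverse_eq_inv', Matrix.smul_apply, smul_eq_mul]
  exact h1.inv.mul h2

theorem measurable_mApp {M : X → Matrix (Fin n) (Fin n) ℂ}
    (hM : ∀ i j, Measurable fun x => M x i j) {f : X → EuclideanSpace ℂ (Fin n)}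
    (hf : Measurable f) : Measurable fun x => mApp (M x) (f x) := by
  have h1 : Measurable fun x => Matrix.toEuclideanCLM (𝕜 := ℂ) (n := Fin n) (M x) :=
    measurable_continuous_comp hM continuous_toEuclideanCLM
  have hc : Continuous fun q : (EuclideanSpace ℂ (Fin n) →L[ℂ] EuclideanSpace ℂ (Fin n)) ×
      EuclideanSpace ℂ (Fin n) => q.1 q.2 := by fun_prop
  have := hc.measurable2 h1 hf
  exact this

theorem measurable_matNorm_mul {M N : X → Matrix (Fin n) (Fin n) ℂ}
    (hM : ∀ i j, Measurable fun x => M x i j) (hN : ∀ i j, Measurable fun x => N x i j) :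
    Measurable fun x => matNorm (M x * N x) := by
  refine measurable_continuous_comp (M := fun x => M x * N x) (fun i j => ?_)
    continuous_toEuclideanCLM.norm
  simp only [Matrix.mul_apply]
  exact Finset.measurable_fun_sum _ fun k _ => (hM i k).mul (hN k j)

end MatrixMeasurability

section MatrixAp

open DCube

variable {d n : ℕ} {p c₁ c₂ : ℝ} {W : (Fin d → ℝ) → Matrix (Fin n) (Fin n) ℂ}
  {V : DCube d → Matrix (Fin n) (Fin n) ℂ}

/-- The kernel `‖W^{1/p}(x) W^{-1/p}(t)‖` of the matrix `A_p` condition. -/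
def apKernel (W : (Fin d → ℝ) → Matrix (Fin n) (Fin n) ℂ) (x t : Fin d → ℝ) : ℝ≥0∞ :=
  ENNReal.ofReal (matNorm (W x * (W t)⁻¹))

theorem enorm_mApp_le_apKernel (x t : Fin d → ℝ) (v : EuclideanSpace ℂ (Fin n)) :
    ‖mApp (W x) (mApp (W t)⁻¹ v)‖ₑ ≤ apKernel W x t * ‖v‖ₑ := by
  rw [← mApp_mul, apKernel, ← ofReal_norm, ← ofReal_norm, ← ENNReal.ofReal_mul (matNorm_nonneg _)]
  exact ENNReal.ofReal_le_ofReal (norm_mApp_le _ _)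

theorem measurable_apKernel (hW : MatMeasurable W) (x : Fin d → ℝ) :
    Measurable (apKernel W x) :=
  (measurable_matNorm_mul (M := fun _ => W x) (fun _ _ => measurable_const)
    (measurable_inv_apply hW)).ennreal_ofReal

theorem volume_ne_zero (L : DCube d) : volume L.set ≠ 0 := by
  rw [volume_set]; exact ofReal_vol_ne_zero L

theorem volume_ne_top (L : DCube d) : volume L.set ≠ ⊤ := by
  rw [volume_set]; exact ENNReal.ofReal_ne_top

theorem lintegral_apKernel_le (hp : 1 < p) (L : DCube d) :
    ∫⁻ x in L.set, (∫⁻ t in L.set, apKernel W x t ^ (p / (p - 1))) ^ (p - 1) ≤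
      apNorm p W * volume L.set ^ p := by
  have hp1 : 0 < p - 1 := by linarith
  have hv0 := volume_ne_zero L
  have hv := volume_ne_top L
  have hsub : L.set ⊆ cubeSet L.corner L.side := fun x hx i =>
    ⟨(hx i).1, (hx i).2.le.trans (by rw [corner, side]; linarith)⟩
  have hside : 0 < L.side := by unfold side; positivity
  have hvol : ENNReal.ofReal (L.side ^ d) = volume L.set := by rw [volume_set]; rfl
  have h1 : (ENNReal.ofReal (L.side ^ d))⁻¹ * ∫⁻ x in cubeSet L.corner L.side,
        ((ENNReal.ofReal (L.side ^ d))⁻¹ * ∫⁻ t in cubeSet L.corner L.side,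
              ENNReal.ofReal (matNorm (W x * (W t)⁻¹)) ^ (p / (p - 1))) ^ (p - 1) ≤
      apNorm p W := by
    unfold apNorm
    exact le_iSup_of_le L.corner (le_iSup_of_le L.side (le_iSup_of_le hside le_rfl))
  rw [hvol] at h1
  have h2 : (volume L.set ^ p)⁻¹ *
      ∫⁻ x in L.set, (∫⁻ t in L.set, apKernel W x t ^ (p / (p - 1))) ^ (p - 1) ≤ apNorm p W := by
    refine le_trans ?_ h1
    calc _ = (volume L.set)⁻¹ * ∫⁻ x in L.set, ((volume L.set)⁻¹ *
          ∫⁻ t in L.set, apKernel W x t ^ (p / (p - 1))) ^ (p - 1) := by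
          simp_rw [ENNReal.mul_rpow_of_nonneg _ _ hp1.le]
          rw [lintegral_const_mul' _ _ (ENNReal.rpow_ne_top_of_nonneg hp1.le
            (ENNReal.inv_ne_top.2 hv0)), ← mul_assoc, ENNReal.inv_rpow,
            ← ENNReal.mul_inv (Or.inl hv0) (Or.inl hv)]
          congr 2
          nth_rw 2 [← ENNReal.rpow_one (volume L.set)]
          rw [← ENNReal.rpow_add _ _ hv0 hv]
          congr 1
          ring
      _ ≤ _ := by
          unfold apKernel
          gcongr
  rwa [mul_comm, ← div_eq_mul_inv, ENNReal.div_le_iff_le_mul] at h2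
  · exact Or.inl (by simp [hv0, hv, ENNReal.rpow_eq_zero_iff])
  · exact Or.inl (ENNReal.rpow_ne_top_of_nonneg (by linarith) hv)

theorem lintegral_rpow_le_of_le_apKernel (hp : 1 < p) (hW : MatMeasurable W) (L : DCube d)
    {ψ φ : (Fin d → ℝ) → ℝ≥0∞} (hφ : AEMeasurable φ (volume.restrict L.set))
    (hfin : ∫⁻ t in L.set, φ t ^ p ≠ ⊤)
    (h : ∀ᵐ x ∂volume.restrict L.set, ψ x ≤ ∫⁻ t in L.set, apKernel W x t * φ t) :
    ∫⁻ x in L.set, ψ x ^ p ≤ apNorm p W * volume L.set ^ p * ∫⁻ t in L.set, φ t ^ p := by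
  have hp0 : 0 < p := by linarith
  have hp1 : 0 < p - 1 := by linarith
  have hpq : (p / (p - 1)).HolderConjugate p := (Real.HolderConjugate.conjExponent hp).symm
  calc ∫⁻ x in L.set, ψ x ^ p
      ≤ ∫⁻ x in L.set, (∫⁻ t in L.set, apKernel W x t ^ (p / (p - 1))) ^ (p - 1) *
          ∫⁻ t in L.set, φ t ^ p := by
        refine lintegral_mono_ae (h.mono fun x hx => ?_)
        have h2 := hx.trans (ENNReal.lintegral_mul_le_Lp_mul_Lq (volume.restrict L.set) hpq
          (measurable_apKernel hW x).aemeasurable hφ)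
        refine (ENNReal.rpow_le_rpow h2 hp0.le).trans (le_of_eq ?_)
        rw [ENNReal.mul_rpow_of_nonneg _ _ hp0.le, ← ENNReal.rpow_mul, ← ENNReal.rpow_mul]
        congr 2
        · field_simp
        · rw [one_div_mul_cancel hp0.ne', ENNReal.rpow_one]
    _ = (∫⁻ x in L.set, (∫⁻ t in L.set, apKernel W x t ^ (p / (p - 1))) ^ (p - 1)) *
          ∫⁻ t in L.set, φ t ^ p := lintegral_mul_const' _ _ hfin
    _ ≤ _ := by gcongr; exact lintegral_apKernel_le hp L

theorem measurable_enorm_mApp (hW : MatMeasurable W) (e : EuclideanSpace ℂ (Fin n)) :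
    Measurable fun x => ‖mApp (W x) e‖ₑ :=
  (measurable_mApp hW measurable_const).enorm

/-- The doubling-type property of matrix `A_p` weights. -/
theorem volume_rpow_mul_le (hp : 1 < p) (hW : MatMeasurable W)
    (hpos : ∀ᵐ x ∂(volume : Measure (Fin d → ℝ)), (W x).PosDef) (L : DCube d)
    {F : Set (Fin d → ℝ)} (hF : MeasurableSet F) (hFL : F ⊆ L.set)
    (e : EuclideanSpace ℂ (Fin n)) (hfin : ∫⁻ x in L.set, ‖mApp (W x) e‖ₑ ^ p ≠ ⊤) :
    volume F ^ p * ∫⁻ x in L.set, ‖mApp (W x) e‖ₑ ^ p ≤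
      apNorm p W * volume L.set ^ p * ∫⁻ x in F, ‖mApp (W x) e‖ₑ ^ p := by
  have hp0 : 0 < p := by linarith
  have hvF : volume F ≠ ⊤ := ((measure_mono hFL).trans_lt (volume_ne_top L).lt_top).ne
  have hm := measurable_enorm_mApp hW e
  have e1 : ∀ t, F.indicator (fun t => ‖mApp (W t) e‖ₑ) t ^ p =
      F.indicator (fun t => ‖mApp (W t) e‖ₑ ^ p) t := by
    intro t
    by_cases ht : t ∈ F <;> simp [ht, hp0]
  have e2 : ∫⁻ t in L.set, F.indicator (fun t => ‖mApp (W t) e‖ₑ) t ^ p =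
      ∫⁻ t in F, ‖mApp (W t) e‖ₑ ^ p := by
    simp_rw [e1]
    rw [lintegral_indicator hF, Measure.restrict_restrict hF, Set.inter_eq_left.2 hFL]
  have h := lintegral_rpow_le_of_le_apKernel hp hW L
    (ψ := fun x => volume F * ‖mApp (W x) e‖ₑ)
    (φ := F.indicator fun t => ‖mApp (W t) e‖ₑ) (hm.indicator hF).aemeasurable
    (by rw [e2]; exact ((lintegral_mono_set hFL).trans_lt hfin.lt_top).ne) ?_
  · rw [e2] at h
    refine le_trans (le_of_eq ?_) h
    simp_rw [ENNReal.mul_rpow_of_nonneg _ _ hp0.le]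
    rw [lintegral_const_mul' _ _ (ENNReal.rpow_ne_top_of_nonneg hp0.le hvF)]
  · refine Filter.Eventually.of_forall fun x => ?_
    have e3 : ∀ t, apKernel W x t * F.indicator (fun t => ‖mApp (W t) e‖ₑ) t =
        F.indicator (fun t => apKernel W x t * ‖mApp (W t) e‖ₑ) t := by
      intro t
      by_cases ht : t ∈ F <;> simp [ht]
    simp_rw [e3]
    rw [lintegral_indicator hF, Measure.restrict_restrict hF, Set.inter_eq_left.2 hFL, mul_comm,
      ← setLIntegral_const]
    refine lintegral_mono_ae ((ae_restrict_of_ae hpos).mono fun t ht => ?_)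
    conv_lhs => rw [← mApp_inv_mApp ht e]
    exact enorm_mApp_le_apKernel x t _

theorem redAvgD_rpow {q : ℝ} (hq : 0 < q) (M : (Fin d → ℝ) → Matrix (Fin n) (Fin n) ℂ)
    (L : DCube d) (e : EuclideanSpace ℂ (Fin n)) :
    volume L.set * redAvgD q M L e ^ q = ∫⁻ x in L.set, ‖mApp (M x) e‖ₑ ^ q := by
  rw [redAvgD, ← ENNReal.rpow_mul, one_div_mul_cancel hq.ne', ENNReal.rpow_one, ← mul_assoc,
    ← volume_set, ENNReal.mul_inv_cancel (volume_ne_zero L) (volume_ne_top L), one_mul]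
  simp_rw [ofReal_norm]

theorem IsReducing.lintegral_le (hp : 1 < p) (hV : IsReducing p c₁ c₂ W V) (L : DCube d)
    (e : EuclideanSpace ℂ (Fin n)) :
    ENNReal.ofReal c₁ ^ p * ∫⁻ x in L.set, ‖mApp (W x) e‖ₑ ^ p ≤
      volume L.set * ‖mApp (V L) e‖ₑ ^ p := by
  have hp0 : 0 < p := by linarith
  have h := ENNReal.rpow_le_rpow ((hV L).2 e).1 hp0.le
  rw [ENNReal.mul_rpow_of_nonneg _ _ hp0.le, ofReal_norm] at h
  rw [← redAvgD_rpow hp0, mul_left_comm]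
  gcongr

theorem IsReducing.le_lintegral (hp : 1 < p) (hV : IsReducing p c₁ c₂ W V) (L : DCube d)
    (e : EuclideanSpace ℂ (Fin n)) :
    volume L.set * ‖mApp (V L) e‖ₑ ^ p ≤
      ENNReal.ofReal c₂ ^ p * ∫⁻ x in L.set, ‖mApp (W x) e‖ₑ ^ p := by
  have hp0 : 0 < p := by linarith
  have h := ENNReal.rpow_le_rpow ((hV L).2 e).2 hp0.le
  rw [ENNReal.mul_rpow_of_nonneg _ _ hp0.le, ofReal_norm] at h
  rw [← redAvgD_rpow hp0, mul_left_comm]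
  gcongr

theorem IsReducing.lintegral_ne_top (hp : 1 < p) (hc₁ : 0 < c₁) (hV : IsReducing p c₁ c₂ W V)
    (L : DCube d) (e : EuclideanSpace ℂ (Fin n)) :
    ∫⁻ x in L.set, ‖mApp (W x) e‖ₑ ^ p ≠ ⊤ := by
  have hp0 : 0 < p := by linarith
  intro h
  have h1 := hV.lintegral_le hp L e
  rw [h, ENNReal.mul_top (by simp [ENNReal.rpow_eq_zero_iff, hc₁, hp0.not_gt]),
    top_le_iff] at h1
  exact ENNReal.mul_ne_top (volume_ne_top L)
    (ENNReal.rpow_ne_top_of_nonneg hp0.le enorm_ne_top) h1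

theorem one_le_apNorm (hn : 0 < n) (hp : 1 < p) (hc₁ : 0 < c₁)
    (hW : MatMeasurable W) (hpos : ∀ᵐ x ∂(volume : Measure (Fin d → ℝ)), (W x).PosDef)
    (hV : IsReducing p c₁ c₂ W V) : 1 ≤ apNorm p W := by
  have hp0 : 0 < p := by linarith
  set L : DCube d := ⟨0, 0⟩
  set e : EuclideanSpace ℂ (Fin n) := stdVec ⟨0, hn⟩ with he
  have hfin := hV.lintegral_ne_top hp hc₁ L e
  have h := volume_rpow_mul_le hp hW hpos L L.measurableSet_set subset_rfl e hfin
  have h0 : ∫⁻ x in L.set, ‖mApp (W x) e‖ₑ ^ p ≠ 0 := by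
    intro h0
    have h1 := hV.le_lintegral hp L e
    rw [h0, mul_zero, nonpos_iff_eq_zero, mul_eq_zero, or_iff_right (volume_ne_zero L),
      ENNReal.rpow_eq_zero_iff_of_pos hp0, enorm_eq_zero] at h1
    have h2 := mApp_inv_mApp (hV L).1 e
    rw [h1, mApp, map_zero] at h2
    have := norm_stdVec (⟨0, hn⟩ : Fin n)
    rw [← he, ← h2, norm_zero] at this
    exact zero_ne_one this
  have hv : volume L.set ^ p ≠ 0 := by
    simp [ENNReal.rpow_eq_zero_iff, volume_ne_zero L, volume_ne_top L]
  have hv' : volume L.set ^ p ≠ ⊤ := ENNReal.rpow_ne_top_of_nonneg hp0.le (volume_ne_top L)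
  have hX : volume L.set ^ p * ∫⁻ x in L.set, ‖mApp (W x) e‖ₑ ^ p ≠ 0 := mul_ne_zero hv h0
  have hX' := ENNReal.mul_ne_top hv' hfin
  rw [mul_assoc] at h
  conv_lhs at h => rw [← one_mul (_ * _)]
  exact (ENNReal.mul_le_mul_iff_left hX hX').1 h

end MatrixAp

section MatrixApDual

open DCube

variable {d n : ℕ} {p c₁ c₂ : ℝ} {W : (Fin d → ℝ) → Matrix (Fin n) (Fin n) ℂ}
  {V : DCube d → Matrix (Fin n) (Fin n) ℂ}

theorem enorm_mApp_inv_le_apKernel {x t : Fin d → ℝ} (hx : (W x).PosDef) (ht : (W t).PosDef)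
    (v : EuclideanSpace ℂ (Fin n)) :
    ‖mApp (W t)⁻¹ v‖ₑ ≤ apKernel W x t * ‖mApp (W x)⁻¹ v‖ₑ := by
  conv_lhs => rw [← mApp_mApp_inv hx v, ← mApp_mul]
  rw [apKernel, matNorm_mul_comm hx.isHermitian ht.inv.isHermitian, ← ofReal_norm, ← ofReal_norm,
    ← ENNReal.ofReal_mul (matNorm_nonneg _)]
  exact ENNReal.ofReal_le_ofReal (norm_mApp_le _ _)

theorem exists_posDef_lintegral_apKernel_ne_top (hp : 1 < p)
    (hpos : ∀ᵐ x ∂(volume : Measure (Fin d → ℝ)), (W x).PosDef) (hA : apNorm p W < ⊤)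
    (L : DCube d) :
    ∃ x, (W x).PosDef ∧ ∫⁻ t in L.set, apKernel W x t ^ (p / (p - 1)) ≠ ⊤ := by
  have hp1 : 0 < p - 1 := by linarith
  have h : ∃ᵐ x ∂volume.restrict L.set,
      ¬ ∫⁻ t in L.set, apKernel W x t ^ (p / (p - 1)) = ⊤ := by
    rw [Filter.Frequently]
    simp only [not_not]
    intro h
    have h1 := lintegral_apKernel_le (W := W) hp L
    rw [lintegral_congr_ae (g := fun _ => ⊤) (h.mono fun x hx => by
      simp only [hx, ENNReal.top_rpow_of_pos hp1]), setLIntegral_const,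
      ENNReal.top_mul (volume_ne_zero L), top_le_iff] at h1
    exact ENNReal.mul_ne_top hA.ne
      (ENNReal.rpow_ne_top_of_nonneg (by linarith) (volume_ne_top L)) h1
  obtain ⟨x, hx⟩ := (h.and_eventually (ae_restrict_of_ae hpos)).exists
  exact ⟨x, hx.2, hx.1⟩

theorem norm_rpow_smul {E : Type*} [NormedAddCommGroup E] [NormedSpace ℝ E] {q : ℝ} (hq : 1 < q)
    (y : E) : ‖‖y‖ ^ (q - 2) • y‖ = ‖y‖ ^ (q - 1) := by
  rcases eq_or_ne y 0 with rfl | hy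
  · rw [smul_zero, norm_zero, Real.zero_rpow (by linarith)]
  · rw [norm_smul, Real.norm_of_nonneg (by positivity)]
    have := norm_pos_iff.2 hy
    conv_lhs => rw [← Real.rpow_one ‖y‖]
    rw [← Real.rpow_mul this.le, ← Real.rpow_add this]
    congr 1
    ring

theorem inner_norm_rpow_smul {q : ℝ} (hq : 1 < q) (y : EuclideanSpace ℂ (Fin n)) :
    inner ℂ y (‖y‖ ^ (q - 2) • y) = ((‖y‖ ^ q : ℝ) : ℂ) := by
  rcases eq_or_ne y 0 with rfl | hy
  · rw [smul_zero, inner_zero_right, norm_zero, Real.zero_rpow (by linarith), Complex.ofReal_zero]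
  · have := norm_pos_iff.2 hy
    have hr : ‖y‖ ^ q = ‖y‖ ^ (q - 2) * ‖y‖ ^ 2 := by
      rw [← Real.rpow_natCast, ← Real.rpow_add this]
      congr 1
      norm_num
    rw [inner_smul_right_eq_smul, inner_self_eq_norm_sq_to_K, Complex.real_smul, hr,
      Complex.ofReal_mul, Complex.ofReal_pow]
    rfl

/-- Self-improvement of the bound produced by duality. -/
theorem le_of_mul_rpow_le {S v B : ℝ≥0∞} (hp : 1 < p) (hS : S ≠ ⊤) (hv0 : v ≠ 0) (hv : v ≠ ⊤)
    (h : v * S ^ p ≤ B * v ^ p * S) : S ≤ B ^ (1 / (p - 1)) * v := by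
  have hp1 : 0 < p - 1 := by linarith
  rcases eq_or_ne S 0 with rfl | hS0
  · exact zero_le
  have e : ∀ {a : ℝ≥0∞}, a ≠ 0 → a ≠ ⊤ → a ^ p = a ^ (p - 1) * a := fun {a} ha0 ha => by
    nth_rw 3 [← ENNReal.rpow_one a]
    rw [← ENNReal.rpow_add _ _ ha0 ha, sub_add_cancel]
  have h' : (v * S) * S ^ (p - 1) ≤ (v * S) * (B * v ^ (p - 1)) := by
    calc _ = v * S ^ p := by rw [e hS0 hS]; ring
      _ ≤ _ := h
      _ = _ := by rw [e hv0 hv]; ring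
  have h2 := (ENNReal.mul_le_mul_iff_right (mul_ne_zero hv0 hS0) (ENNReal.mul_ne_top hv hS)).1 h'
  have h3 := ENNReal.rpow_le_rpow h2 (one_div_nonneg.2 hp1.le)
  rw [ENNReal.mul_rpow_of_nonneg _ _ (one_div_nonneg.2 hp1.le), ← ENNReal.rpow_mul,
    ← ENNReal.rpow_mul, mul_one_div_cancel hp1.ne', ENNReal.rpow_one, ENNReal.rpow_one] at h3
  exact h3

theorem IsReducing.lintegral_inv_le (hp : 1 < p) (hW : MatMeasurable W)
    (hpos : ∀ᵐ x ∂(volume : Measure (Fin d → ℝ)), (W x).PosDef) (hA : apNorm p W < ⊤)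
    (hV : IsReducing p c₁ c₂ W V) (L : DCube d) (e : EuclideanSpace ℂ (Fin n)) :
    ∫⁻ t in L.set, ‖mApp (W t)⁻¹ (mApp (V L) e)‖ₑ ^ (p / (p - 1)) ≤
      (ENNReal.ofReal c₂ ^ p * apNorm p W * ‖e‖ₑ ^ p) ^ (1 / (p - 1)) * volume L.set := by
  have hp0 : 0 < p := by linarith
  have hp1 : 0 < p - 1 := by linarith
  set q := p / (p - 1) with hq
  have hq1 : 1 < q := by rw [hq, lt_div_iff₀ hp1]; linarith
  have hqp : (q - 1) * p = q := by rw [hq]; field_simp; ring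
  obtain ⟨x₀, hx₀, hk⟩ := exists_posDef_lintegral_apKernel_ne_top hp hpos hA L
  have hpos' : ∀ᵐ t ∂volume.restrict L.set, (W t).PosDef := ae_restrict_of_ae hpos
  set v := mApp (V L) e with hv
  set g : (Fin d → ℝ) → EuclideanSpace ℂ (Fin n) := fun t => mApp (W t)⁻¹ v with hg
  have hgm : Measurable g := measurable_mApp (measurable_inv_apply hW) measurable_const
  have hkm := measurable_apKernel hW x₀
  set φ : (Fin d → ℝ) → EuclideanSpace ℂ (Fin n) := fun t => ‖g t‖ ^ (q - 2) • g t with hφ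
  have hφm : Measurable φ := (hgm.norm.pow_const _).smul hgm
  have hφn : ∀ t, ‖φ t‖ₑ = ‖g t‖ₑ ^ (q - 1) := fun t => by
    rw [← ofReal_norm, hφ, norm_rpow_smul hq1, ← ENNReal.ofReal_rpow_of_nonneg (norm_nonneg _)
      (by linarith), ofReal_norm]
  have hgk : ∀ᵐ t ∂volume.restrict L.set, ‖g t‖ₑ ≤ apKernel W x₀ t * ‖mApp (W x₀)⁻¹ v‖ₑ :=
    hpos'.mono fun t ht => enorm_mApp_inv_le_apKernel hx₀ ht v
  have hS : ∫⁻ t in L.set, ‖g t‖ₑ ^ q ≠ ⊤ := by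
    refine ((lintegral_mono_ae (hgk.mono fun t ht =>
      ENNReal.rpow_le_rpow ht (by linarith))).trans_lt ?_).ne
    simp_rw [ENNReal.mul_rpow_of_nonneg _ _ (by linarith : 0 ≤ q)]
    rw [lintegral_mul_const' _ _ (ENNReal.rpow_ne_top_of_nonneg (by linarith) enorm_ne_top)]
    exact ENNReal.mul_lt_top hk.lt_top
      (ENNReal.rpow_lt_top_of_nonneg (by linarith) enorm_ne_top)
  have hψm : Measurable fun t => mApp (W t)⁻¹ (φ t) :=
    measurable_mApp (measurable_inv_apply hW) hφm
  have hintegral : Integrable (fun t => mApp (W t)⁻¹ (φ t)) (volume.restrict L.set) := by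
    refine ⟨hψm.aestronglyMeasurable, ?_⟩
    have : ∀ᵐ t ∂volume.restrict L.set, ‖mApp (W t)⁻¹ (φ t)‖ₑ ≤ apKernel W x₀ t ^ q *
        (ENNReal.ofReal (matNorm (W x₀)⁻¹) * ‖mApp (W x₀)⁻¹ v‖ₑ ^ (q - 1)) := by
      filter_upwards [hpos', hgk] with t ht ht'
      calc ‖mApp (W t)⁻¹ (φ t)‖ₑ ≤ apKernel W x₀ t * ‖mApp (W x₀)⁻¹ (φ t)‖ₑ :=
            enorm_mApp_inv_le_apKernel hx₀ ht _
        _ ≤ apKernel W x₀ t * (ENNReal.ofReal (matNorm (W x₀)⁻¹) *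
              (apKernel W x₀ t * ‖mApp (W x₀)⁻¹ v‖ₑ) ^ (q - 1)) := by
            refine mul_le_mul_right ?_ _
            refine le_trans (b := ENNReal.ofReal (matNorm (W x₀)⁻¹) * ‖φ t‖ₑ) ?_ ?_
            · rw [← ofReal_norm, ← ofReal_norm, ← ENNReal.ofReal_mul (matNorm_nonneg _)]
              exact ENNReal.ofReal_le_ofReal (norm_mApp_le _ _)
            · rw [hφn]
              exact mul_le_mul_right (ENNReal.rpow_le_rpow ht' (by linarith)) _
        _ = _ := by
            have hq' : apKernel W x₀ t ^ q = apKernel W x₀ t * apKernel W x₀ t ^ (q - 1) := by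
              conv_rhs => rw [← ENNReal.rpow_one (apKernel W x₀ t), ← ENNReal.rpow_mul, one_mul]
              rw [← ENNReal.rpow_add_of_nonneg _ _ zero_le_one (by linarith)]
              congr 1
              ring
            rw [hq', ENNReal.mul_rpow_of_nonneg _ _ (by linarith : 0 ≤ q - 1)]
            ring
    refine (lintegral_mono_ae this).trans_lt ?_
    have hc : ENNReal.ofReal (matNorm (W x₀)⁻¹) * ‖mApp (W x₀)⁻¹ v‖ₑ ^ (q - 1) ≠ ⊤ :=
      ENNReal.mul_ne_top ENNReal.ofReal_ne_top
        (ENNReal.rpow_ne_top_of_nonneg (by linarith) enorm_ne_top)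
    rw [lintegral_mul_const' _ _ hc]
    exact ENNReal.mul_lt_top hk.lt_top hc.lt_top
  set u := ∫ t in L.set, mApp (W t)⁻¹ (φ t) with hu
  have hSu : ∫⁻ t in L.set, ‖g t‖ₑ ^ q ≤ ‖e‖ₑ * ‖mApp (V L) u‖ₑ := by
    have h1 : inner ℂ v u = ((∫ t in L.set, ‖g t‖ ^ q : ℝ) : ℂ) := by
      rw [hu, ← integral_inner hintegral, ← integral_complex_ofReal]
      refine integral_congr_ae (hpos'.mono fun t ht => ?_)
      change inner ℂ v (mApp (W t)⁻¹ (φ t)) = _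
      rw [← inner_mApp_left ht.inv.isHermitian]
      exact inner_norm_rpow_smul hq1 (g t)
    have h2 : ∫⁻ t in L.set, ‖g t‖ₑ ^ q = ENNReal.ofReal (∫ t in L.set, ‖g t‖ ^ q) := by
      have he : ∀ t, ENNReal.ofReal (‖g t‖ ^ q) = ‖g t‖ₑ ^ q := fun t => by
        rw [← ENNReal.ofReal_rpow_of_nonneg (norm_nonneg _) (by linarith), ofReal_norm]
      rw [integral_eq_lintegral_of_nonneg_ae (Filter.Eventually.of_forall fun t => by positivity)
        (hgm.norm.pow_const _).aestronglyMeasurable]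
      simp_rw [he]
      rw [ENNReal.ofReal_toReal hS]
    rw [h2, ← ofReal_norm, ← ofReal_norm, ← ENNReal.ofReal_mul (norm_nonneg _)]
    refine ENNReal.ofReal_le_ofReal ?_
    have h3 := norm_inner_le_norm (𝕜 := ℂ) e (mApp (V L) u)
    rw [← inner_mApp_left (hV L).1.isHermitian, ← hv, h1, Complex.norm_real] at h3
    exact (le_abs_self _).trans h3
  have hφp : ∀ t, ‖φ t‖ₑ ^ p = ‖g t‖ₑ ^ q := fun t => by
    rw [hφn, ← ENNReal.rpow_mul, hqp]
  have hKP := lintegral_rpow_le_of_le_apKernel hp hW L (ψ := fun x => ‖mApp (W x) u‖ₑ)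
    (φ := fun t => ‖φ t‖ₑ) hφm.enorm.aemeasurable (by simpa only [hφp] using hS)
    (Filter.Eventually.of_forall fun x => by
      have : mApp (W x) u = ∫ t in L.set, mApp (W x) (mApp (W t)⁻¹ (φ t)) :=
        (ContinuousLinearMap.integral_comp_comm _ hintegral).symm
      rw [this]
      exact (enorm_integral_le_lintegral_enorm _).trans
        (lintegral_mono fun t => enorm_mApp_le_apKernel x t _))
  simp_rw [hφp] at hKP
  refine le_of_mul_rpow_le hp hS (volume_ne_zero L) (volume_ne_top L) ?_
  calc volume L.set * (∫⁻ t in L.set, ‖g t‖ₑ ^ q) ^ p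
      ≤ volume L.set * (‖e‖ₑ * ‖mApp (V L) u‖ₑ) ^ p := by gcongr
    _ = ‖e‖ₑ ^ p * (volume L.set * ‖mApp (V L) u‖ₑ ^ p) := by
        rw [ENNReal.mul_rpow_of_nonneg _ _ hp0.le]; ring
    _ ≤ ‖e‖ₑ ^ p * (ENNReal.ofReal c₂ ^ p * ∫⁻ x in L.set, ‖mApp (W x) u‖ₑ ^ p) :=
        mul_le_mul_right (hV.le_lintegral hp L u) _
    _ ≤ ‖e‖ₑ ^ p * (ENNReal.ofReal c₂ ^ p *
          (apNorm p W * volume L.set ^ p * ∫⁻ t in L.set, ‖g t‖ₑ ^ q)) :=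
        mul_le_mul_right (mul_le_mul_right hKP _) _
    _ = _ := by ring

theorem IsReducing.le_lintegral_inv (hp : 1 < p) (hW : MatMeasurable W)
    (hpos : ∀ᵐ x ∂(volume : Measure (Fin d → ℝ)), (W x).PosDef)
    (hV : IsReducing p c₁ c₂ W V) (J : DCube d) (v : EuclideanSpace ℂ (Fin n)) :
    (ENNReal.ofReal c₁ * ‖mApp (V J)⁻¹ v‖ₑ) ^ (p / (p - 1)) * volume J.set ≤
      ∫⁻ t in J.set, ‖mApp (W t)⁻¹ v‖ₑ ^ (p / (p - 1)) := by
  have hp0 : 0 < p := by linarith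
  have hp1 : 0 < p - 1 := by linarith
  have hpq : (p / (p - 1)).HolderConjugate p := (Real.HolderConjugate.conjExponent hp).symm
  set q := p / (p - 1) with hq
  have hq0 : 0 < q := div_pos hp0 hp1
  set y := mApp (V J)⁻¹ v with hy
  set z := mApp (V J)⁻¹ y with hz
  have hVz : mApp (V J) z = y := mApp_mApp_inv (hV J).1 y
  set S := ∫⁻ t in J.set, ‖mApp (W t)⁻¹ v‖ₑ ^ q with hS
  have h1 : ‖y‖ₑ * ‖y‖ₑ * volume J.set ≤
      S ^ (1 / q) * (∫⁻ t in J.set, ‖mApp (W t) z‖ₑ ^ p) ^ (1 / p) := by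
    refine le_trans ?_ (ENNReal.lintegral_mul_le_Lp_mul_Lq (volume.restrict J.set) hpq
      (measurable_mApp (measurable_inv_apply hW) measurable_const).enorm.aemeasurable
      (measurable_enorm_mApp hW z).aemeasurable)
    rw [← setLIntegral_const]
    refine lintegral_mono_ae ((ae_restrict_of_ae hpos).mono fun t ht => ?_)
    change ‖y‖ₑ * ‖y‖ₑ ≤ ‖mApp (W t)⁻¹ v‖ₑ * ‖mApp (W t) z‖ₑ
    rw [← ofReal_norm, ← ofReal_norm, ← ofReal_norm, ← ENNReal.ofReal_mul (norm_nonneg _),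
      ← ENNReal.ofReal_mul (norm_nonneg _)]
    refine ENNReal.ofReal_le_ofReal ?_
    have h2 : inner ℂ (mApp (W t)⁻¹ v) (mApp (W t) z) = inner ℂ y y := by
      rw [← inner_mApp_left ht.isHermitian, mApp_mApp_inv ht, hz,
        ← inner_mApp_left (hV J).1.inv.isHermitian]
    have h3 := norm_inner_le_norm (𝕜 := ℂ) (mApp (W t)⁻¹ v) (mApp (W t) z)
    rw [h2, inner_self_eq_norm_sq_to_K, norm_pow] at h3
    simpa [sq] using h3
  have h2 : ENNReal.ofReal c₁ * (∫⁻ t in J.set, ‖mApp (W t) z‖ₑ ^ p) ^ (1 / p) ≤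
      volume J.set ^ (1 / p) * ‖y‖ₑ := by
    have := ENNReal.rpow_le_rpow (hV.lintegral_le hp J z) (one_div_nonneg.2 hp0.le)
    rw [hVz, ENNReal.mul_rpow_of_nonneg _ _ (one_div_nonneg.2 hp0.le),
      ENNReal.mul_rpow_of_nonneg _ _ (one_div_nonneg.2 hp0.le), ← ENNReal.rpow_mul,
      ← ENNReal.rpow_mul, mul_one_div_cancel hp0.ne', ENNReal.rpow_one, ENNReal.rpow_one] at this
    exact this
  rcases eq_or_ne y 0 with hy0 | hy0
  · simp [hy0, hq0]
  have hv0 := volume_ne_zero J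
  have hv := volume_ne_top J
  have hsplit : volume J.set = volume J.set ^ (1 / p) * volume J.set ^ (1 / q) := by
    rw [← ENNReal.rpow_add _ _ hv0 hv, one_div, one_div, add_comm, hpq.inv_add_inv_eq_one,
      ENNReal.rpow_one]
  have h3 : (‖y‖ₑ * volume J.set ^ (1 / p)) *
      (ENNReal.ofReal c₁ * ‖y‖ₑ * volume J.set ^ (1 / q)) ≤
        (‖y‖ₑ * volume J.set ^ (1 / p)) * S ^ (1 / q) := by
    calc _ = ENNReal.ofReal c₁ * (‖y‖ₑ * ‖y‖ₑ *
          (volume J.set ^ (1 / p) * volume J.set ^ (1 / q))) := by ring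
      _ = ENNReal.ofReal c₁ * (‖y‖ₑ * ‖y‖ₑ * volume J.set) := by rw [← hsplit]
      _ ≤ ENNReal.ofReal c₁ *
          (S ^ (1 / q) * (∫⁻ t in J.set, ‖mApp (W t) z‖ₑ ^ p) ^ (1 / p)) :=
          mul_le_mul_right h1 _
      _ = S ^ (1 / q) *
          (ENNReal.ofReal c₁ * (∫⁻ t in J.set, ‖mApp (W t) z‖ₑ ^ p) ^ (1 / p)) := by ring
      _ ≤ S ^ (1 / q) * (volume J.set ^ (1 / p) * ‖y‖ₑ) := mul_le_mul_right h2 _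
      _ = _ := by ring
  have h4 := (ENNReal.mul_le_mul_iff_right (mul_ne_zero (enorm_ne_zero.2 hy0)
    (ENNReal.rpow_pos hv0.bot_lt hv).ne') (ENNReal.mul_ne_top enorm_ne_top
      (ENNReal.rpow_ne_top_of_nonneg (by positivity) hv))).1 h3
  have h5 := ENNReal.rpow_le_rpow h4 hq0.le
  rwa [ENNReal.mul_rpow_of_nonneg _ _ hq0.le, ← ENNReal.rpow_mul, ← ENNReal.rpow_mul,
    one_div_mul_cancel hq0.ne', ENNReal.rpow_one, ENNReal.rpow_one] at h5

end MatrixApDual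

section BadSets

open DCube

variable {d n : ℕ} {N : ℤ} {s u T : ℕ} {L : DCube d} {x : Fin d → ℝ}
  {F : (Fin d → ℝ) → EuclideanSpace ℂ (Fin n)}

theorem atPt_set_subset (hL : L.k = N - s) (hsu : s ≤ u) (hx : x ∈ L.set) :
    (atPt (N - u) x).set ⊆ L.set := by
  intro y hy
  have h := atPt_eq_of_depth_le hsu (atPt_of_mem hy (atPt_k _ _))
  rw [mem_set_iff, hL, h]
  exact atPt_of_mem hx hL

theorem volume_mul_cubeNormAvg (F : (Fin d → ℝ) → EuclideanSpace ℂ (Fin n)) (L : DCube d) :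
    cubeNormAvg F L * volume L.set = ∫⁻ x in L.set, ‖F x‖ₑ := by
  rw [cubeNormAvg, ← volume_set, mul_comm, ← mul_assoc,
    ENNReal.mul_inv_cancel (volume_ne_zero L) (volume_ne_top L), one_mul]

theorem cubeNormAvg_ne_top (hF : Integrable F) (L : DCube d) : cubeNormAvg F L ≠ ⊤ := by
  refine ENNReal.mul_ne_top (ENNReal.inv_ne_top.2 (ofReal_vol_ne_zero L)) ?_
  exact ((setLIntegral_le_lintegral _ _).trans_lt hF.2).ne

theorem cubeNormAvg_eq_zero_of_subset {J : DCube d} (h : cubeNormAvg F L = 0)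
    (hJ : J.set ⊆ L.set) : cubeNormAvg F J = 0 := by
  have h1 := volume_mul_cubeNormAvg F L
  rw [h, zero_mul] at h1
  have h2 : ∫⁻ x in J.set, ‖F x‖ₑ = 0 :=
    le_antisymm ((lintegral_mono_set hJ).trans h1.symm.le) zero_le
  rw [cubeNormAvg, h2, mul_zero]

/-- The points below which the averages of `‖F‖` grow too much. -/
def growthSet (F : (Fin d → ℝ) → EuclideanSpace ℂ (Fin n)) (N : ℤ) (s T : ℕ) (L : DCube d) :
    Set (Fin d → ℝ) :=
  {x | ∃ u, s < u ∧ u ≤ T ∧ 8 * cubeNormAvg F L < cubeNormAvg F (atPt (N - u) x)}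

/-- The points below which the Haar energy becomes too large. -/
def energySet (F : (Fin d → ℝ) → EuclideanSpace ℂ (Fin n)) (N : ℤ) (s T : ℕ) (L : DCube d) :
    Set (Fin d → ℝ) :=
  {x | ∃ u, s < u ∧ u ≤ T ∧ 512 * 8 ^ d * cubeNormAvg F L ^ 2 <
    ∑ v ∈ Finset.Ico s u, haarEnergy F (atPt (N - v) x)}

theorem volume_growthSet_le (hF : Integrable F) (hsT : s ≤ T) (hL : L.k = N - s) :
    8 * volume (L.set ∩ growthSet F N s T L) ≤ volume L.set := by
  rcases eq_or_ne (cubeNormAvg F L) 0 with h0 | h0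
  · have : L.set ∩ growthSet F N s T L = ∅ := by
      refine Set.eq_empty_of_forall_notMem fun x ⟨hx, u, hsu, _, hu⟩ => ?_
      rw [cubeNormAvg_eq_zero_of_subset h0 (atPt_set_subset hL hsu.le hx)] at hu
      exact ENNReal.not_lt_zero hu
    simp [this]
  · have h := measure_exists_bad_le volume (fun x => ‖F x‖ₑ) (8 * cubeNormAvg F L)
      (fun J => 8 * cubeNormAvg F L < cubeNormAvg F J) N (T - s) s L hL fun J _ hJ => by
        rw [← volume_mul_cubeNormAvg]
        exact mul_le_mul_left hJ.le _
    rw [Nat.add_sub_cancel' hsT, ← volume_mul_cubeNormAvg] at h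
    refine (ENNReal.mul_le_mul_iff_right h0 (cubeNormAvg_ne_top hF L)).1 (le_trans ?_ h)
    rw [mul_left_comm, mul_assoc]
    rfl

theorem volume_energySet_diff_le (hF : Integrable F) (hsT : s ≤ T) (hL : L.k = N - s) :
    8 * volume ((L.set ∩ energySet F N s T L) \ growthSet F N s T L) ≤ volume L.set := by
  set a := cubeNormAvg F L with ha
  rcases eq_or_ne a 0 with h0 | h0
  · have : L.set ∩ energySet F N s T L = ∅ := by
      refine Set.eq_empty_of_forall_notMem fun x ⟨hx, u, hsu, _, hu⟩ => ?_
      rw [Finset.sum_eq_zero] at hu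
      · exact ENNReal.not_lt_zero hu
      · intro v hv
        refine le_antisymm ((haarEnergy_le hF _).trans ?_) zero_le
        rw [cubeNormAvg_eq_zero_of_subset h0
          (atPt_set_subset hL (Finset.mem_Ico.1 hv).1 hx)]
        simp
    simp [this]
  have hat : a ≠ ⊤ := cubeNormAvg_ne_top hF L
  have hsub : (L.set ∩ energySet F N s T L) \ growthSet F N s T L ⊆
      {x | 512 * 8 ^ d * a ^ 2 ≤ stoppedEnergy F (8 * a) (T - s) (N - s) x} ∩ L.set := by
    rintro x ⟨⟨hx, u, hsu, huT, hu⟩, hg⟩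
    refine ⟨?_, hx⟩
    rw [Set.mem_ofPred_eq, stoppedEnergy_eq_sum]
    · refine hu.le.trans ?_
      rw [Finset.sum_Ico_eq_sum_range]
      refine le_trans (Finset.sum_le_sum_of_subset
        (Finset.range_mono (Nat.sub_le_sub_right huT s))) (le_of_eq ?_)
      refine Finset.sum_congr rfl fun j _ => ?_
      rw [Nat.cast_add, sub_sub]
    · intro j hj
      have hj' : (N - s - j : ℤ) = N - (s + j : ℕ) := by push_cast; ring
      rw [hj']
      rcases Nat.eq_zero_or_pos j with rfl | hj0
      · rw [add_zero, atPt_of_mem hx hL, ← ha]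
        exact le_mul_of_one_le_left zero_le (by norm_num)
      · by_contra! hc
        exact hg ⟨s + j, by omega, by omega, hc⟩
  have hm : Measurable (stoppedEnergy F (8 * a) (T - s) (N - s)) :=
    measurable_stoppedEnergy F _ _ _
  have h1 := mul_meas_ge_le_lintegral₀ (μ := volume.restrict L.set) hm.aemeasurable
    (512 * 8 ^ d * a ^ 2)
  rw [Measure.restrict_apply (measurableSet_le measurable_const hm), ← hL] at h1
  have h2 := lintegral_stoppedEnergy_add_le (κ := 8 * a) hF (T - s) L (by
    rw [← ha, ← mul_assoc]
    refine le_mul_of_one_le_left zero_le ?_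
    calc (1 : ℝ≥0∞) ≤ 2 ^ d := one_le_pow₀ (by norm_num)
      _ ≤ 2 ^ d * 8 := le_mul_of_one_le_right zero_le (by norm_num))
  rw [← hL] at hsub
  have h3 : (64 * 8 ^ d * a ^ 2) *
      (8 * volume ((L.set ∩ energySet F N s T L) \ growthSet F N s T L)) ≤
      (64 * 8 ^ d * a ^ 2) * volume L.set := by
    calc _ = 512 * 8 ^ d * a ^ 2 *
          volume ((L.set ∩ energySet F N s T L) \ growthSet F N s T L) := by ring
      _ ≤ _ := mul_le_mul_right (measure_mono hsub) _
      _ ≤ _ := h1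
      _ ≤ _ := le_self_add.trans h2
      _ = _ := by
        have : (8 : ℝ≥0∞) ^ d = 2 ^ d * (2 ^ d * 2 ^ d) := by
          rw [← mul_pow, ← mul_pow]; norm_num
        rw [this]; ring
  refine (ENNReal.mul_le_mul_iff_right ?_ ?_).1 h3
  · simp [h0]
  · exact ENNReal.mul_ne_top (ENNReal.mul_ne_top (by simp) (by simp)) (by simp [hat])

end BadSets

section ReducingStop

open DCube

variable {d n : ℕ} {p c₁ c₂ : ℝ} {W : (Fin d → ℝ) → Matrix (Fin n) (Fin n) ℂ}
  {V : DCube d → Matrix (Fin n) (Fin n) ℂ} {N : ℤ} {s T : ℕ} {L : DCube d}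

theorem volume_reducingSet_le (hn : 0 < n) (hp : 1 < p) (hc₁ : 0 < c₁) (hc₂ : 0 < c₂)
    (hW : MatMeasurable W)
    (hpos : ∀ᵐ x ∂(volume : Measure (Fin d → ℝ)), (W x).PosDef) (hA : apNorm p W < ⊤)
    (hV : IsReducing p c₁ c₂ W V) {Λ : ℝ≥0∞}
    (hΛ : 8 * n * (ENNReal.ofReal c₂ * apNorm p W ^ (1 / p)) ≤ ENNReal.ofReal c₁ * Λ)
    (hsT : s ≤ T) (hL : L.k = N - s) :
    8 * volume (L.set ∩ {x | ∃ u, s < u ∧ u ≤ T ∧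
      ∃ i, Λ < ‖mApp (V (atPt (N - u) x))⁻¹ (mApp (V L) (stdVec i))‖ₑ}) ≤ volume L.set := by
  have hp0 : 0 < p := by linarith
  have hp1 : 0 < p - 1 := by linarith
  have hA1 := one_le_apNorm hn hp hc₁ hW hpos hV
  set D := ENNReal.ofReal c₂ * apNorm p W ^ (1 / p) with hD
  set q := p / (p - 1) with hq
  have hq1 : 1 < q := by rw [hq, lt_div_iff₀ hp1]; linarith
  have hn1 : (1 : ℝ≥0∞) ≤ n := by exact_mod_cast hn
  have hD0 : D ≠ 0 := mul_ne_zero (ENNReal.ofReal_pos.2 hc₂).ne'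
    (ENNReal.rpow_pos (zero_lt_one.trans_le hA1) hA.ne).ne'
  have hDt : D ≠ ⊤ := ENNReal.mul_ne_top ENNReal.ofReal_ne_top
    (ENNReal.rpow_ne_top_of_nonneg (by positivity) hA.ne)
  set E : Fin n → Set (Fin d → ℝ) := fun i => {x | ∃ u, s < u ∧ u ≤ T ∧
    Λ < ‖mApp (V (atPt (N - u) x))⁻¹ (mApp (V L) (stdVec i))‖ₑ} with hE
  have hEi : ∀ i, 8 * n * volume (L.set ∩ E i) ≤ volume L.set := by
    intro i
    have h := measure_exists_bad_le volume
      (fun t => ‖mApp (W t)⁻¹ (mApp (V L) (stdVec i))‖ₑ ^ q) ((8 * n * D) ^ q)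
      (fun J => Λ < ‖mApp (V J)⁻¹ (mApp (V L) (stdVec i))‖ₑ) N (T - s) s L hL fun J _ hJ => by
        refine le_trans ?_ (hV.le_lintegral_inv hp hW hpos J _)
        refine mul_le_mul_left (ENNReal.rpow_le_rpow (hΛ.trans ?_) (by linarith)) _
        exact mul_le_mul_right hJ.le _
    rw [Nat.add_sub_cancel' hsT] at h
    have h2 := h.trans (hV.lintegral_inv_le hp hW hpos hA L (stdVec i))
    have hDq : (ENNReal.ofReal c₂ ^ p * apNorm p W * ‖stdVec i‖ₑ ^ p) ^ (1 / (p - 1)) =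
        D ^ q := by
      have : ‖stdVec i‖ₑ = 1 := by rw [← ofReal_norm, norm_stdVec, ENNReal.ofReal_one]
      rw [this, ENNReal.one_rpow, mul_one]
      have : ENNReal.ofReal c₂ ^ p * apNorm p W = D ^ p := by
        rw [hD, ENNReal.mul_rpow_of_nonneg _ _ hp0.le, ← ENNReal.rpow_mul,
          one_div_mul_cancel hp0.ne', ENNReal.rpow_one]
      rw [this, ← ENNReal.rpow_mul, mul_one_div]
    rw [hDq, ENNReal.mul_rpow_of_nonneg _ _ (by linarith : 0 ≤ q), mul_comm (_ ^ q),
      mul_assoc] at h2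
    have h3 := (ENNReal.mul_le_mul_iff_right
      (ENNReal.rpow_pos hD0.bot_lt hDt).ne'
      (ENNReal.rpow_ne_top_of_nonneg (by linarith) hDt)).1 h2
    refine le_trans (mul_le_mul_left ?_ _) h3
    have h8 : (1 : ℝ≥0∞) ≤ 8 * n := hn1.trans (le_mul_of_one_le_left zero_le (by norm_num))
    calc (8 * n : ℝ≥0∞) = (8 * n) ^ (1 : ℝ) := (ENNReal.rpow_one _).symm
      _ ≤ _ := ENNReal.rpow_le_rpow_of_exponent_le h8 hq1.le
  have hsub : L.set ∩ {x | ∃ u, s < u ∧ u ≤ T ∧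
      ∃ i, Λ < ‖mApp (V (atPt (N - u) x))⁻¹ (mApp (V L) (stdVec i))‖ₑ} ⊆
      ⋃ i, L.set ∩ E i := by
    rintro x ⟨hx, u, hsu, huT, i, hi⟩
    exact Set.mem_iUnion.2 ⟨i, hx, u, hsu, huT, hi⟩
  have hn0 : (n : ℝ≥0∞) ≠ 0 := by exact_mod_cast hn.ne'
  refine (ENNReal.mul_le_mul_iff_right hn0 (ENNReal.natCast_ne_top n)).1 ?_
  calc (n : ℝ≥0∞) * (8 * volume _) ≤ n * (8 * ∑ i, volume (L.set ∩ E i)) := by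
        gcongr
        exact (measure_mono hsub).trans ((measure_iUnion_le _).trans_eq (tsum_fintype _))
    _ = ∑ i, 8 * n * volume (L.set ∩ E i) := by
        rw [← mul_assoc, Finset.mul_sum, mul_comm (n : ℝ≥0∞)]
    _ ≤ ∑ _i : Fin n, volume L.set := Finset.sum_le_sum fun i _ => hEi i
    _ = _ := by simp

end ReducingStop

section ReducingBad

open DCube

variable {d n : ℕ} {p c₁ c₂ : ℝ} {W : (Fin d → ℝ) → Matrix (Fin n) (Fin n) ℂ}
  {V : DCube d → Matrix (Fin n) (Fin n) ℂ} {f : (Fin d → ℝ) → EuclideanSpace ℂ (Fin n)}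
  {N : ℤ} {s T : ℕ} {L : DCube d} {Λ δ : ℝ≥0∞}

/-- The function `f` normalized by the reducing operator of the cube `L`. -/
def normalized (V : DCube d → Matrix (Fin n) (Fin n) ℂ)
    (f : (Fin d → ℝ) → EuclideanSpace ℂ (Fin n)) (L : DCube d) (x : Fin d → ℝ) :
    EuclideanSpace ℂ (Fin n) :=
  mApp (V L)⁻¹ (f x)

theorem integrable_normalized (hf : Integrable f) (L : DCube d) :
    Integrable (normalized V f L) :=
  ContinuousLinearMap.integrable_comp _ hf

/-- The stopping condition at generation `t`, for the cubes of generation `t` inside a cube of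
generation `s`. -/
def ReducingBad (V : DCube d → Matrix (Fin n) (Fin n) ℂ)
    (f : (Fin d → ℝ) → EuclideanSpace ℂ (Fin n)) (Λ : ℝ≥0∞) (N : ℤ) (s t : ℕ)
    (x : Fin d → ℝ) : Prop :=
  (∃ i, Λ < ‖mApp (V (atPt (N - t) x))⁻¹ (mApp (V (atPt (N - s) x)) (stdVec i))‖ₑ) ∨
  8 * cubeNormAvg (normalized V f (atPt (N - s) x)) (atPt (N - s) x) <
    cubeNormAvg (normalized V f (atPt (N - s) x)) (atPt (N - t) x) ∨
  512 * 8 ^ d * cubeNormAvg (normalized V f (atPt (N - s) x)) (atPt (N - s) x) ^ 2 <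
    ∑ v ∈ Finset.Ico s t, haarEnergy (normalized V f (atPt (N - s) x)) (atPt (N - v) x)

theorem isLocal_reducingBad : IsLocal N (ReducingBad V f Λ N) := by
  intro s t hst x y h
  have h1 := atPt_eq_of_depth_le hst h
  have h2 : ∑ v ∈ Finset.Ico s t, haarEnergy (normalized V f (atPt (N - s) y)) (atPt (N - v) x) =
      ∑ v ∈ Finset.Ico s t, haarEnergy (normalized V f (atPt (N - s) y)) (atPt (N - v) y) :=
    Finset.sum_congr rfl fun v hv => by
      rw [atPt_eq_of_depth_le (Finset.mem_Ico.1 hv).2.le h]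
  rw [ReducingBad, ReducingBad, h, h1, h2]

theorem retainsMass_volume (hn : 0 < n) (hp : 1 < p) (hc₁ : 0 < c₁) (hc₂ : 0 < c₂)
    (hW : MatMeasurable W)
    (hpos : ∀ᵐ x ∂(volume : Measure (Fin d → ℝ)), (W x).PosDef) (hA : apNorm p W < ⊤)
    (hV : IsReducing p c₁ c₂ W V) (hf : Integrable f)
    (hΛ : 8 * n * (ENNReal.ofReal c₂ * apNorm p W ^ (1 / p)) ≤ ENNReal.ofReal c₁ * Λ) :
    RetainsMass N T (ReducingBad V f Λ N) volume 2⁻¹ := by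
  intro s hs L hL
  set F := normalized V f L with hF
  have hFi : Integrable F := integrable_normalized hf L
  set R : Set (Fin d → ℝ) := {x | ∃ u, s < u ∧ u ≤ T ∧
    ∃ i, Λ < ‖mApp (V (atPt (N - u) x))⁻¹ (mApp (V L) (stdVec i))‖ₑ} with hR
  have h1 : 8 * volume (L.set ∩ R) ≤ volume L.set :=
    volume_reducingSet_le hn hp hc₁ hc₂ hW hpos hA hV hΛ hs hL
  have h2 := volume_growthSet_le hFi hs hL
  have h3 := volume_energySet_diff_le hFi hs hL
  have hsub : L.set ∩ {x | ∃ u, s < u ∧ u ≤ T ∧ ReducingBad V f Λ N s u x} ⊆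
      (L.set ∩ R) ∪ (L.set ∩ growthSet F N s T L) ∪
        ((L.set ∩ energySet F N s T L) \ growthSet F N s T L) := by
    rintro x ⟨hx, u, hsu, huT, h⟩
    rw [ReducingBad, atPt_of_mem hx hL] at h
    rcases h with h | h | h
    · exact Or.inl (Or.inl ⟨hx, u, hsu, huT, h⟩)
    · exact Or.inl (Or.inr ⟨hx, u, hsu, huT, h⟩)
    · by_cases hg : x ∈ growthSet F N s T L
      · exact Or.inl (Or.inr ⟨hx, hg⟩)
      · exact Or.inr ⟨⟨hx, u, hsu, huT, h⟩, hg⟩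
  set B := L.set ∩ {x | ∃ u, s < u ∧ u ≤ T ∧ ReducingBad V f Λ N s u x}
  have h4 : volume B ≤ volume (L.set ∩ R) + volume (L.set ∩ growthSet F N s T L) +
      volume ((L.set ∩ energySet F N s T L) \ growthSet F N s T L) :=
    (measure_mono hsub).trans ((measure_union_le _ _).trans
      (add_le_add_left (measure_union_le _ _) _))
  have h5 : 8 * volume B ≤ 4 * volume L.set := by
    calc 8 * volume B ≤ 8 * volume (L.set ∩ R) + 8 * volume (L.set ∩ growthSet F N s T L) +
          8 * volume ((L.set ∩ energySet F N s T L) \ growthSet F N s T L) := by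
          rw [← mul_add, ← mul_add]; exact mul_le_mul_right h4 _
      _ ≤ volume L.set + volume L.set + volume L.set := by gcongr
      _ = 3 * volume L.set := by ring
      _ ≤ 4 * volume L.set := by gcongr; norm_num
  have h6 : volume B ≤ 2⁻¹ * volume L.set := by
    have h8 : (8 : ℝ≥0∞) = 4 * 2 := by norm_num
    rw [h8, mul_assoc] at h5
    have h7 := (ENNReal.mul_le_mul_iff_right (by norm_num) (by norm_num)).1 h5
    rw [mul_comm, ← div_eq_mul_inv]
    rwa [ENNReal.le_div_iff_mul_le (by norm_num) (by norm_num), mul_comm]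
  calc _ ≤ 2⁻¹ * volume L.set + 2⁻¹ * volume L.set := add_le_add_right h6 _
    _ = volume L.set := by rw [← add_mul, ENNReal.inv_two_add_inv_two, one_mul]

/-- Sets retained in the sense of Lebesgue measure are retained in the sense of the scalar
weights `|W^{1/p} e|^p`. -/
theorem RetainsMass.withDensity {Bad : ℕ → ℕ → (Fin d → ℝ) → Prop} (hB : IsLocal N Bad)
    (H : RetainsMass N T Bad volume 2⁻¹) (hn : 0 < n) (hp : 1 < p) (hc₁ : 0 < c₁)
    (hW : MatMeasurable W)
    (hpos : ∀ᵐ x ∂(volume : Measure (Fin d → ℝ)), (W x).PosDef)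
    (hV : IsReducing p c₁ c₂ W V) (e : EuclideanSpace ℂ (Fin n)) :
    RetainsMass N T Bad (volume.withDensity fun x => ‖mApp (W x) e‖ₑ ^ p)
      (2 ^ p * apNorm p W)⁻¹ := by
  intro s hs L hL
  have hp0 : 0 < p := by linarith
  have hA1 := one_le_apNorm hn hp hc₁ hW hpos hV
  set B := {x | ∃ u, s < u ∧ u ≤ T ∧ Bad s u x} with hBdef
  have hBm : MeasurableSet B := hB.measurableSet_bad le_rfl
  have hLm := L.measurableSet_set
  have h1 := H s hs L hL
  set w : (Fin d → ℝ) → ℝ≥0∞ := fun x => ‖mApp (W x) e‖ₑ ^ p with hw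
  have hv0 := volume_ne_zero L
  have hv := volume_ne_top L
  have hF : 2⁻¹ * volume L.set ≤ volume (L.set \ B) := by
    have h2 := measure_inter_add_sdiff (μ := volume) L.set hBm
    rw [← h2, add_comm _ (volume (L.set \ B))] at h1
    have h3 := (ENNReal.add_le_add_iff_right
      ((measure_mono Set.inter_subset_left).trans_lt hv.lt_top).ne).1 h1
    rwa [add_comm, h2] at h3
  have h2 := volume_rpow_mul_le hp hW hpos L (hLm.diff hBm) Set.sdiff_subset e
    (hV.lintegral_ne_top hp hc₁ L e)
  have hkey : (2 ^ p * apNorm p W)⁻¹ * ∫⁻ x in L.set, w x ≤ ∫⁻ x in L.set \ B, w x := by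
    have hvp0 : volume L.set ^ p ≠ 0 := (ENNReal.rpow_pos hv0.bot_lt hv).ne'
    have hvp : volume L.set ^ p ≠ ⊤ := ENNReal.rpow_ne_top_of_nonneg hp0.le hv
    have hA0 : apNorm p W ≠ 0 := (zero_lt_one.trans_le hA1).ne'
    have h20 : (2 : ℝ≥0∞) ^ p ≠ 0 := (ENNReal.rpow_pos (by norm_num) (by norm_num)).ne'
    have h2t : (2 : ℝ≥0∞) ^ p ≠ ⊤ := ENNReal.rpow_ne_top_of_nonneg hp0.le (by norm_num)
    rw [mul_comm, ← div_eq_mul_inv]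
    refine ENNReal.div_le_of_le_mul ?_
    refine (ENNReal.mul_le_mul_iff_right (mul_ne_zero (ENNReal.inv_ne_zero.2 h2t) hvp0)
      (ENNReal.mul_ne_top (ENNReal.inv_ne_top.2 h20) hvp)).1 ?_
    calc ((2 : ℝ≥0∞) ^ p)⁻¹ * volume L.set ^ p * ∫⁻ x in L.set, w x
        = (2⁻¹ * volume L.set) ^ p * ∫⁻ x in L.set, w x := by
          rw [ENNReal.mul_rpow_of_nonneg _ _ hp0.le, ENNReal.inv_rpow]
      _ ≤ volume (L.set \ B) ^ p * ∫⁻ x in L.set, w x := by gcongr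
      _ ≤ _ := h2
      _ = (((2 : ℝ≥0∞) ^ p)⁻¹ * 2 ^ p) * (apNorm p W * volume L.set ^ p *
            ∫⁻ x in L.set \ B, w x) := by rw [ENNReal.inv_mul_cancel h20 h2t, one_mul]
      _ = _ := by ring
  rw [← measure_inter_add_sdiff (μ := volume.withDensity w) L.set hBm, add_comm
    (volume.withDensity w (L.set ∩ B)) (volume.withDensity w (L.set \ B))]
  refine add_le_add_left ?_ _
  rw [add_comm, measure_inter_add_sdiff _ hBm, withDensity_apply _ hLm,
    withDensity_apply _ (hLm.diff hBm)]
  exact hkey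

theorem enorm_mApp_le_sum_mul (M : Matrix (Fin n) (Fin n) ℂ) (v : EuclideanSpace ℂ (Fin n)) :
    ‖mApp M v‖ₑ ≤ (∑ i, ‖mApp M (stdVec i)‖ₑ) * ‖v‖ₑ := by
  have h := ENNReal.ofReal_le_ofReal (norm_mApp_le_sum M v)
  rw [ENNReal.ofReal_mul (Finset.sum_nonneg fun _ _ => norm_nonneg _),
    ENNReal.ofReal_sum_of_nonneg fun _ _ => norm_nonneg _] at h
  simpa only [ofReal_norm] using h

theorem sum_haarCoef_le (hf : Integrable f) (hV : ∀ I, (V I).PosDef) {Q : DCube d}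
    (hQ : ∀ i, ‖mApp (V Q)⁻¹ (mApp (V L) (stdVec i))‖ₑ ≤ Λ) :
    ∑ ε ∈ Sfin d, ENNReal.ofReal (‖mApp (V Q)⁻¹ (haarCoef f Q ε)‖ ^ 2) / ENNReal.ofReal Q.vol ≤
      (n * Λ) ^ 2 * haarEnergy (normalized V f L) Q := by
  rw [haarEnergy, Finset.mul_sum]
  refine Finset.sum_le_sum fun ε _ => ?_
  rw [← mul_div_assoc]
  refine ENNReal.div_le_div_right ?_ _
  rw [ENNReal.ofReal_pow (norm_nonneg _), ENNReal.ofReal_pow (norm_nonneg _), ofReal_norm,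
    ofReal_norm, ← mul_pow]
  refine pow_le_pow_left₀ zero_le ?_ 2
  have h1 : mApp (V Q)⁻¹ (haarCoef f Q ε) =
      mApp ((V Q)⁻¹ * V L) (haarCoef (normalized V f L) Q ε) := by
    unfold normalized
    rw [← mApp_haarCoef _ hf, mApp_mul, mApp_mApp_inv (hV L)]
  rw [h1]
  refine (enorm_mApp_le_sum_mul _ _).trans (mul_le_mul_left ?_ _)
  calc _ ≤ ∑ _i : Fin n, Λ := Finset.sum_le_sum fun i _ => by rw [mApp_mul]; exact hQ i
    _ = _ := by simp

/-- The energy between two stopping generations is controlled by the average at the first. -/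
theorem sum_energy_le (hf : Integrable f) (hV : ∀ I, (V I).PosDef) (hΛ : 1 ≤ Λ)
    {x : Fin d → ℝ} {t : ℕ} (hst : s ≤ t)
    (hx : ∀ u, s < u → u ≤ t → ¬ ReducingBad V f Λ N s u x) :
    ∑ v ∈ Finset.Icc s t, ∑ ε ∈ Sfin d,
        ENNReal.ofReal (‖mApp (V (atPt (N - v) x))⁻¹ (haarCoef f (atPt (N - v) x) ε)‖ ^ 2) /
          ENNReal.ofReal (atPt (N - v) x).vol ≤
      (n * Λ * (24 * 4 ^ d) *
        cubeNormAvg (normalized V f (atPt (N - s) x)) (atPt (N - s) x)) ^ 2 := by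
  set L := atPt (N - s) x with hL
  set F := normalized V f L with hF
  set a := cubeNormAvg F L with ha
  have hFi : Integrable F := integrable_normalized hf L
  have h1 : ∀ v ∈ Finset.Icc s t, ∑ ε ∈ Sfin d,
        ENNReal.ofReal (‖mApp (V (atPt (N - v) x))⁻¹ (haarCoef f (atPt (N - v) x) ε)‖ ^ 2) /
          ENNReal.ofReal (atPt (N - v) x).vol ≤
      (n * Λ) ^ 2 * haarEnergy F (atPt (N - v) x) := by
    intro v hv
    obtain ⟨hsv, hvt⟩ := Finset.mem_Icc.1 hv
    refine sum_haarCoef_le hf hV fun i => ?_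
    rcases hsv.eq_or_lt with rfl | hsv
    · rw [← hL, mApp_inv_mApp (hV L), ← ofReal_norm, norm_stdVec, ENNReal.ofReal_one]
      exact hΛ
    · have := hx v hsv hvt
      rw [ReducingBad, not_or, not_exists] at this
      exact not_lt.1 (this.1 i)
  have h2 : ∑ v ∈ Finset.Icc s t, haarEnergy F (atPt (N - v) x) ≤ (24 * 4 ^ d * a) ^ 2 := by
    have h24 : (24 * 4 ^ d * a) ^ 2 = 576 * 16 ^ d * a ^ 2 := by
      have : (16 : ℝ≥0∞) ^ d = 4 ^ d * 4 ^ d := by rw [← mul_pow]; norm_num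
      rw [this]; ring
    have h2d : (2 : ℝ≥0∞) ^ d ≤ 16 ^ d := pow_le_pow_left₀ zero_le (by norm_num) d
    have h8d : (8 : ℝ≥0∞) ^ d ≤ 16 ^ d := pow_le_pow_left₀ zero_le (by norm_num) d
    rw [h24]
    rcases hst.eq_or_lt with rfl | hst
    · rw [Finset.Icc_self, Finset.sum_singleton, ← hL]
      refine (haarEnergy_le hFi L).trans (mul_le_mul_left (h2d.trans ?_) _)
      exact le_mul_of_one_le_left zero_le (by norm_num)
    · have := hx t hst le_rfl
      rw [ReducingBad, not_or, not_or, not_lt, not_lt] at this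
      obtain ⟨-, hb, hc⟩ := this
      rw [← Finset.sum_Ico_add_eq_sum_Icc hst.le]
      calc _ ≤ 512 * 8 ^ d * a ^ 2 + 2 ^ d * (8 * a) ^ 2 :=
            add_le_add hc ((haarEnergy_le hFi _).trans
              (mul_le_mul_right (pow_le_pow_left₀ zero_le hb 2) _))
        _ ≤ 512 * 16 ^ d * a ^ 2 + 16 ^ d * (8 * a) ^ 2 := by gcongr
        _ = _ := by ring
  calc _ ≤ ∑ v ∈ Finset.Icc s t, (n * Λ) ^ 2 * haarEnergy F (atPt (N - v) x) :=
        Finset.sum_le_sum h1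
    _ ≤ (n * Λ) ^ 2 * (24 * 4 ^ d * a) ^ 2 := by
        rw [← Finset.mul_sum]; exact mul_le_mul_right h2 _
    _ = _ := by ring

end ReducingBad

section WeightedAverage

open DCube

variable {d n : ℕ} {p c₁ c₂ : ℝ} {W : (Fin d → ℝ) → Matrix (Fin n) (Fin n) ℂ}
  {V : DCube d → Matrix (Fin n) (Fin n) ℂ} {f : (Fin d → ℝ) → EuclideanSpace ℂ (Fin n)}
  {N : ℤ} {s T : ℕ} {L : DCube d} {δ : ℝ≥0∞} {Bad : ℕ → ℕ → (Fin d → ℝ) → Prop}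

theorem lintegral_mul_stopCount_le (hp : 1 < p) (hc₁ : 0 < c₁) (hW : MatMeasurable W)
    (hV : IsReducing p c₁ c₂ W V) (hB : IsLocal N Bad) (hδ0 : δ ≠ 0) (hδ : δ ≠ ⊤)
    (H : ∀ e, RetainsMass N T Bad (volume.withDensity fun x => ‖mApp (W x) e‖ₑ ^ p) δ)
    (hs : s ≤ T) (hL : L.k = N - s) (hlast : ∀ x ∈ L.set, lastStop Bad s x = s)
    {e : EuclideanSpace ℂ (Fin n)} (he : ‖mApp (V L) e‖ₑ = 1) :
    ∫⁻ x in L.set, ‖mApp (W x) e‖ₑ ^ p * (1 + δ) ^ stopCount Bad T s x ≤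
      δ⁻¹ * (ENNReal.ofReal c₁ ^ p)⁻¹ * volume L.set := by
  have hp0 : 0 < p := by linarith
  have h1 := lintegral_pow_stopCount_le hB (H e) hs L hL hlast
  have hm : Measurable fun x => ‖mApp (W x) e‖ₑ ^ p := (measurable_enorm_mApp hW e).pow_const _
  have hN : Measurable fun x => (1 + δ) ^ stopCount Bad T s x :=
    (measurable_of_countable fun k : ℕ => (1 + δ) ^ k).comp (hB.measurable_stopCount T s)
  rw [setLIntegral_withDensity_eq_setLIntegral_mul _ hm hN L.measurableSet_set,
    withDensity_apply _ L.measurableSet_set] at h1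
  have h2 := hV.lintegral_le hp L e
  rw [he, ENNReal.one_rpow, mul_one] at h2
  have hc0 : ENNReal.ofReal c₁ ^ p ≠ 0 :=
    (ENNReal.rpow_pos (ENNReal.ofReal_pos.2 hc₁) ENNReal.ofReal_ne_top).ne'
  have hct : ENNReal.ofReal c₁ ^ p ≠ ⊤ := ENNReal.rpow_ne_top_of_nonneg hp0.le
    ENNReal.ofReal_ne_top
  refine (ENNReal.mul_le_mul_iff_right (mul_ne_zero hc0 hδ0) (ENNReal.mul_ne_top hct hδ)).1 ?_
  calc _ = ENNReal.ofReal c₁ ^ p * (δ * ∫⁻ x in L.set, ‖mApp (W x) e‖ₑ ^ p *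
        (1 + δ) ^ stopCount Bad T s x) := by ring
    _ ≤ ENNReal.ofReal c₁ ^ p * ∫⁻ x in L.set, ‖mApp (W x) e‖ₑ ^ p := mul_le_mul_right h1 _
    _ ≤ volume L.set := h2
    _ = (ENNReal.ofReal c₁ ^ p * (ENNReal.ofReal c₁ ^ p)⁻¹) * (δ * δ⁻¹) * volume L.set := by
        rw [ENNReal.mul_inv_cancel hc0 hct, ENNReal.mul_inv_cancel hδ0 hδ, one_mul, one_mul]
    _ = _ := by ring

theorem enorm_mApp_mul_le_sum {M N : Matrix (Fin n) (Fin n) ℂ} (hM : M.IsHermitian)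
    (hN : N.IsHermitian) (v : EuclideanSpace ℂ (Fin n)) :
    ‖mApp (M * N) v‖ₑ ≤ ∑ i, ‖mApp N (mApp M (stdVec i))‖ₑ * ‖v‖ₑ := by
  have h := ENNReal.ofReal_le_ofReal (norm_mApp_mul_le_sum hM hN v)
  rw [ENNReal.ofReal_mul (Finset.sum_nonneg fun _ _ => norm_nonneg _),
    ENNReal.ofReal_sum_of_nonneg fun _ _ => norm_nonneg _] at h
  simpa only [ofReal_norm, mApp_mul, Finset.sum_mul] using h

theorem lintegral_mul_le_weighted (hp : 1 < p) {μ : Measure (Fin d → ℝ)}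
    {m g : (Fin d → ℝ) → ℝ≥0∞} (hm : Measurable m) (hg : Measurable g)
    {k : (Fin d → ℝ) → ℕ} (hk : Measurable k) {r : ℝ≥0∞} (hr0 : r ≠ 0) (hr : r ≠ ⊤) :
    ∫⁻ x, m x * g x ∂μ ≤ (∫⁻ x, m x ^ p * r ^ k x ∂μ) ^ (1 / p) *
      (∫⁻ x, g x ^ (p / (p - 1)) * (r ^ (-(1 / (p - 1)))) ^ k x ∂μ) ^ (1 / (p / (p - 1))) := by
  have hp0 : 0 < p := by linarith
  have hp1 : 0 < p - 1 := by linarith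
  have hpq : p.HolderConjugate (p / (p - 1)) := Real.HolderConjugate.conjExponent hp
  have hq0 : 0 < p / (p - 1) := div_pos hp0 hp1
  have hk' : ∀ z : ℝ, Measurable fun x => r ^ ((k x : ℝ) * z) := fun z =>
    (measurable_of_countable fun j : ℕ => r ^ ((j : ℝ) * z)).comp hk
  have h := ENNReal.lintegral_mul_le_Lp_mul_Lq μ hpq
    (hm.mul (hk' (1 / p))).aemeasurable (hg.mul (hk' (-(1 / p)))).aemeasurable
  simp only [Pi.mul_apply] at h
  have e1 : ∀ x, m x * r ^ ((k x : ℝ) * (1 / p)) * (g x * r ^ ((k x : ℝ) * -(1 / p))) =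
      m x * g x := fun x => by
    rw [mul_mul_mul_comm, ← ENNReal.rpow_add _ _ hr0 hr]
    simp
  have e2 : ∀ x, (m x * r ^ ((k x : ℝ) * (1 / p))) ^ p = m x ^ p * r ^ k x := fun x => by
    rw [ENNReal.mul_rpow_of_nonneg _ _ hp0.le, ← ENNReal.rpow_mul, ← ENNReal.rpow_natCast]
    congr 2
    field_simp
  have e3 : ∀ x, (g x * r ^ ((k x : ℝ) * -(1 / p))) ^ (p / (p - 1)) =
      g x ^ (p / (p - 1)) * (r ^ (-(1 / (p - 1)))) ^ k x := fun x => by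
    rw [ENNReal.mul_rpow_of_nonneg _ _ hq0.le, ← ENNReal.rpow_mul, ← ENNReal.rpow_natCast,
      ← ENNReal.rpow_mul]
    congr 2
    field_simp
  simpa only [e1, e2, e3] using h

theorem cubeNormAvg_rpow_mul_le (hp : 1 < p) (hc₁ : 0 < c₁) (hW : MatMeasurable W)
    (hpos : ∀ᵐ x ∂(volume : Measure (Fin d → ℝ)), (W x).PosDef)
    (hV : IsReducing p c₁ c₂ W V) (hf : Measurable f) (hB : IsLocal N Bad) (hδ0 : δ ≠ 0)
    (hδ : δ ≠ ⊤)
    (H : ∀ e, RetainsMass N T Bad (volume.withDensity fun x => ‖mApp (W x) e‖ₑ ^ p) δ)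
    (hs : s ≤ T) (hL : L.k = N - s) (hlast : ∀ x ∈ L.set, lastStop Bad s x = s) :
    cubeNormAvg (normalized V f L) L ^ (p / (p - 1)) * volume L.set ≤
      (n : ℝ≥0∞) ^ (p / (p - 1)) * (δ⁻¹ * (ENNReal.ofReal c₁ ^ p)⁻¹) ^ (1 / (p - 1)) *
        ∫⁻ x in L.set, ‖mApp (W x)⁻¹ (f x)‖ₑ ^ (p / (p - 1)) *
          ((1 + δ) ^ (-(1 / (p - 1)))) ^ stopCount Bad T s x := by
  have hp0 : 0 < p := by linarith
  have hp1 : 0 < p - 1 := by linarith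
  set q := p / (p - 1) with hq
  have hq0 : 0 < q := div_pos hp0 hp1
  have hqp : 1 / p * q = 1 / (p - 1) := by rw [hq]; field_simp
  set K := δ⁻¹ * (ENNReal.ofReal c₁ ^ p)⁻¹ with hK
  set R := ∫⁻ x in L.set, ‖mApp (W x)⁻¹ (f x)‖ₑ ^ q *
    ((1 + δ) ^ (-(1 / (p - 1)))) ^ stopCount Bad T s x with hR
  set m : Fin n → (Fin d → ℝ) → ℝ≥0∞ := fun i x => ‖mApp (W x) (mApp (V L)⁻¹ (stdVec i))‖ₑ
    with hm
  have hgm : Measurable fun x => ‖mApp (W x)⁻¹ (f x)‖ₑ :=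
    (measurable_mApp (measurable_inv_apply hW) hf).enorm
  have hmm : ∀ i, Measurable (m i) := fun i => measurable_enorm_mApp hW _
  have h1 : ∀ i, ∫⁻ x in L.set, m i x * ‖mApp (W x)⁻¹ (f x)‖ₑ ≤
      (K * volume L.set) ^ (1 / p) * R ^ (1 / q) := by
    intro i
    refine (lintegral_mul_le_weighted hp (hmm i) hgm (hB.measurable_stopCount T s)
      (r := 1 + δ) (by simp) (by simp [hδ])).trans ?_
    refine mul_le_mul_left (ENNReal.rpow_le_rpow ?_ (by positivity)) _
    refine lintegral_mul_stopCount_le hp hc₁ hW hV hB hδ0 hδ H hs hL hlast ?_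
    rw [mApp_mApp_inv (hV L).1, ← ofReal_norm, norm_stdVec, ENNReal.ofReal_one]
  have h2 : cubeNormAvg (normalized V f L) L * volume L.set ≤
      n * ((K * volume L.set) ^ (1 / p) * R ^ (1 / q)) := by
    rw [volume_mul_cubeNormAvg]
    calc _ ≤ ∫⁻ x in L.set, ∑ i, m i x * ‖mApp (W x)⁻¹ (f x)‖ₑ := by
          refine lintegral_mono_ae ((ae_restrict_of_ae hpos).mono fun x hx => ?_)
          have h3 := enorm_mApp_mul_le_sum (hV L).1.inv.isHermitian hx.isHermitian
            (mApp (W x)⁻¹ (f x))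
          rwa [mApp_mul, mApp_mApp_inv hx] at h3
      _ = ∑ i, ∫⁻ x in L.set, m i x * ‖mApp (W x)⁻¹ (f x)‖ₑ :=
          lintegral_finsetSum _ fun i _ => (hmm i).mul hgm
      _ ≤ ∑ _i : Fin n, (K * volume L.set) ^ (1 / p) * R ^ (1 / q) :=
          Finset.sum_le_sum fun i _ => h1 i
      _ = _ := by simp
  have hv0 := volume_ne_zero L
  have hv := volume_ne_top L
  have h3 := ENNReal.rpow_le_rpow h2 hq0.le
  have hz : 0 ≤ 1 / (p - 1) := one_div_nonneg.2 hp1.le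
  rw [ENNReal.mul_rpow_of_nonneg _ _ hq0.le, ENNReal.mul_rpow_of_nonneg _ _ hq0.le,
    ENNReal.mul_rpow_of_nonneg _ _ hq0.le, ← ENNReal.rpow_mul, ← ENNReal.rpow_mul, hqp,
    one_div_mul_cancel hq0.ne', ENNReal.rpow_one, ENNReal.mul_rpow_of_nonneg _ _ hz] at h3
  have hvq : volume L.set ^ q = volume L.set * volume L.set ^ (1 / (p - 1)) := by
    conv_rhs => rw [← ENNReal.rpow_one (volume L.set), ← ENNReal.rpow_mul, one_mul]
    rw [← ENNReal.rpow_add _ _ hv0 hv]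
    congr 1
    rw [hq]
    field_simp
    ring
  rw [hvq] at h3
  refine (ENNReal.mul_le_mul_iff_right (ENNReal.rpow_pos hv0.bot_lt hv).ne'
    (ENNReal.rpow_ne_top_of_nonneg hz hv)).1 (le_trans (le_of_eq ?_) (h3.trans (le_of_eq ?_)))
  · ring
  · ring

/-- A lower bound for the gain per generation of stopping cubes. -/
theorem inv_one_sub_rpow_neg_le {κ : ℝ} (hκ : 0 < κ) (hδ0 : δ ≠ 0) (hδ1 : δ ≤ 1) :
    (1 - (1 + δ) ^ (-κ))⁻¹ ≤ ENNReal.ofReal (1 + 2 / κ) * δ⁻¹ := by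
  have hδt : δ ≠ ⊤ := (hδ1.trans_lt ENNReal.one_lt_top).ne
  lift δ to NNReal using hδt
  set x : ℝ := (δ : ℝ) with hx
  have hx0 : 0 < x := by
    rw [hx, NNReal.coe_pos]; exact pos_iff_ne_zero.2 (by exact_mod_cast hδ0)
  have hx1 : x ≤ 1 := by rw [hx]; exact_mod_cast hδ1
  have hδx : (δ : ℝ≥0∞) = ENNReal.ofReal x := (ENNReal.ofReal_coe_nnreal).symm
  have hreal : (1 + x) ^ (-κ) ≤ 1 - x / (1 + 2 / κ) := by
    have h1 : x / 2 ≤ Real.log (1 + x) := by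
      have := Real.one_sub_inv_le_log_of_pos (by linarith : 0 < 1 + x)
      refine le_trans ?_ this
      have : 1 - (1 + x)⁻¹ = x / (1 + x) := by field_simp; ring
      rw [this]
      exact div_le_div_of_nonneg_left hx0.le (by linarith) (by linarith)
    rw [Real.rpow_def_of_pos (by linarith)]
    have h2 : Real.exp (Real.log (1 + x) * -κ) ≤ (1 + κ * x / 2)⁻¹ := by
      rw [mul_neg, Real.exp_neg]
      refine inv_anti₀ (by positivity) ?_
      refine le_trans ?_ (Real.add_one_le_exp _)
      nlinarith
    refine h2.trans ?_
    have h3 : 1 - x / (1 + 2 / κ) = (κ + 2 - κ * x) / (κ + 2) := by field_simp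
    rw [h3, inv_eq_one_div, div_le_div_iff₀ (by positivity) (by positivity)]
    nlinarith [mul_pos hκ hx0, mul_nonneg (mul_nonneg hκ.le hκ.le) (mul_nonneg hx0.le
      (sub_nonneg.2 hx1))]
  have hρ : (1 + (δ : ℝ≥0∞)) ^ (-κ) = ENNReal.ofReal ((1 + x) ^ (-κ)) := by
    rw [hδx, ← ENNReal.ofReal_one, ← ENNReal.ofReal_add zero_le_one hx0.le,
      ENNReal.ofReal_rpow_of_pos (by linarith)]
  have hlow : ENNReal.ofReal (x / (1 + 2 / κ)) ≤ 1 - (1 + (δ : ℝ≥0∞)) ^ (-κ) := by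
    rw [hρ, ← ENNReal.ofReal_one, ← ENNReal.ofReal_sub _ (by positivity)]
    exact ENNReal.ofReal_le_ofReal (by linarith)
  refine (ENNReal.inv_le_inv.2 hlow).trans (le_of_eq ?_)
  rw [← ENNReal.ofReal_inv_of_pos (by positivity), inv_div, div_eq_mul_inv,
    ENNReal.ofReal_mul (by positivity), ENNReal.ofReal_inv_of_pos hx0, ← hδx]

end WeightedAverage

section SquareFunction

open DCube

variable {d n : ℕ} {p c₁ c₂ : ℝ} {W : (Fin d → ℝ) → Matrix (Fin n) (Fin n) ℂ}
  {V : DCube d → Matrix (Fin n) (Fin n) ℂ} {f : (Fin d → ℝ) → EuclideanSpace ℂ (Fin n)}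

/-- The contribution of the cube `I` to the square function of `sqFn`. -/
def cubeEnergy (A : DCube d → Matrix (Fin n) (Fin n) ℂ)
    (f : (Fin d → ℝ) → EuclideanSpace ℂ (Fin n)) (I : DCube d) : ℝ≥0∞ :=
  ∑ ε ∈ Sfin d, ENNReal.ofReal (‖mApp (A I) (haarCoef f I ε)‖ ^ 2) / ENNReal.ofReal I.vol

theorem sqFn_eq_tsum (A : DCube d → Matrix (Fin n) (Fin n) ℂ)
    (f : (Fin d → ℝ) → EuclideanSpace ℂ (Fin n)) (x : Fin d → ℝ) :
    sqFn A f x = ∑' k : ℤ, cubeEnergy A f (atPt k x) := by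
  have h1 : ∀ I : DCube d, ∑ ε ∈ Sfin d, Set.indicator I.set
      (fun _ => ENNReal.ofReal (‖mApp (A I) (haarCoef f I ε)‖ ^ 2) / ENNReal.ofReal I.vol) x =
      I.set.indicator (fun _ => cubeEnergy A f I) x := by
    intro I
    by_cases hx : x ∈ I.set
    · simp only [Set.indicator_of_mem hx, cubeEnergy]
    · simp only [Set.indicator_of_notMem hx, Finset.sum_const_zero]
  rw [sqFn, tsum_congr h1, ← (atPt_injective x).tsum_eq]
  · exact tsum_congr fun k => Set.indicator_of_mem (mem_atPt k x) _
  · intro I hI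
    by_contra hne
    refine hI (Set.indicator_of_notMem (fun hx => hne ⟨I.k, mem_set_iff.1 hx⟩) _)

theorem tsum_int_eq_iSup (e : ℤ → ℝ≥0∞) :
    ∑' k, e k = ⨆ M : ℕ, ∑ v ∈ Finset.range (2 * M + 1), e (M - v) := by
  have h1 : ∀ M : ℕ, ∑ v ∈ Finset.range (2 * M + 1), e (M - v) =
      ∑ k ∈ Finset.Icc (-M : ℤ) M, e k := by
    intro M
    refine Finset.sum_bij' (fun v _ => (M : ℤ) - v) (fun k _ => (M - k).toNat) ?_ ?_ ?_ ?_ ?_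
    · intro v hv
      have := Finset.mem_range.1 hv
      rw [Finset.mem_Icc]; omega
    · intro k hk
      have := Finset.mem_Icc.1 hk
      rw [Finset.mem_range]; omega
    · intro v hv
      have := Finset.mem_range.1 hv
      simp
    · intro k hk
      have := Finset.mem_Icc.1 hk
      omega
    · simp
  simp_rw [h1]
  refine ENNReal.tsum_eq_iSup_sum' _ fun t => ?_
  refine ⟨t.sup Int.natAbs, fun k hk => ?_⟩
  have : k.natAbs ≤ t.sup Int.natAbs := Finset.le_sup hk
  rw [Finset.mem_Icc]; omega

theorem lintegral_sqFn_rpow_eq_iSup (A : DCube d → Matrix (Fin n) (Fin n) ℂ)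
    (f : (Fin d → ℝ) → EuclideanSpace ℂ (Fin n)) {r : ℝ} (hr : 0 < r) :
    ∫⁻ x, sqFn A f x ^ r = ⨆ M : ℕ,
      ∫⁻ x, (∑ v ∈ Finset.range (2 * M + 1), cubeEnergy A f (atPt ((M : ℤ) - v) x)) ^ r := by
  rw [← lintegral_iSup]
  · refine lintegral_congr fun x => ?_
    rw [sqFn_eq_tsum, tsum_int_eq_iSup fun k => cubeEnergy A f (atPt k x)]
    exact (ENNReal.orderIsoRpow r hr).map_iSup _
  · exact fun M => (Finset.measurable_fun_sum _ fun v _ =>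
      measurable_of_dcube (cubeEnergy A f) _).pow_const _
  · refine monotone_nat_of_le_succ fun M x => ?_
    refine ENNReal.rpow_le_rpow ?_ hr.le
    have h2 : 2 * (M + 1) + 1 = (2 * M + 1) + 1 + 1 := by ring
    rw [h2, Finset.sum_range_succ' _ (2 * M + 1 + 1), Finset.sum_range_succ _ (2 * M + 1)]
    refine le_trans (le_of_eq (Finset.sum_congr rfl fun v _ => ?_))
      (le_self_add.trans le_self_add)
    congr 2
    push_cast; ring

theorem lintegral_sum_cubeEnergy_le (hn : 0 < n) (hp : 1 < p) (hc₁ : 0 < c₁) (hc₂ : 0 < c₂)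
    (hW : MatMeasurable W) (hpos : ∀ᵐ x ∂(volume : Measure (Fin d → ℝ)), (W x).PosDef)
    (hA : apNorm p W < ⊤) (hV : IsReducing p c₁ c₂ W V) (hf : Integrable f)
    (hfm : Measurable f) {Λ : ℝ≥0∞} (hΛt : Λ ≠ ⊤) (hΛ1 : 1 ≤ Λ)
    (hΛ : 8 * n * (ENNReal.ofReal c₂ * apNorm p W ^ (1 / p)) ≤ ENNReal.ofReal c₁ * Λ)
    (N : ℤ) (T : ℕ) {δ : ℝ≥0∞} (hδ : δ = (2 ^ p * apNorm p W)⁻¹) :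
    ∫⁻ x, (∑ v ∈ Finset.range (T + 1), cubeEnergy (fun I => (V I)⁻¹) f (atPt (N - v) x)) ^
        (p / (p - 1) / 2) ≤
      (n * Λ * (24 * 4 ^ d)) ^ (p / (p - 1)) *
        (stopConst p * ((n : ℝ≥0∞) ^ (p / (p - 1)) *
            (δ⁻¹ * (ENNReal.ofReal c₁ ^ p)⁻¹) ^ (1 / (p - 1))) *
          (1 - (1 + δ) ^ (-(1 / (p - 1))))⁻¹ *
            ∫⁻ x, ‖mApp (W x)⁻¹ (f x)‖ₑ ^ (p / (p - 1))) := by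
  have hp0 : 0 < p := by linarith
  have hq0 : 0 < p / (p - 1) := div_pos hp0 (by linarith)
  have hA1 := one_le_apNorm hn hp hc₁ hW hpos hV
  have h2p : (2 : ℝ≥0∞) ^ p ≠ ⊤ := ENNReal.rpow_ne_top_of_nonneg hp0.le (by simp)
  have hδ0 : δ ≠ 0 := by
    rw [hδ]; exact ENNReal.inv_ne_zero.2 (ENNReal.mul_ne_top h2p hA.ne)
  have hδt : δ ≠ ⊤ := by
    rw [hδ]
    refine ENNReal.inv_ne_top.2 (mul_ne_zero ?_ (zero_lt_one.trans_le hA1).ne')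
    exact (ENNReal.rpow_pos (by simp) (by simp)).ne'
  set Bad := ReducingBad V f Λ N with hBad
  have hB : IsLocal N Bad := isLocal_reducingBad
  have H : RetainsMass N T Bad volume 2⁻¹ :=
    retainsMass_volume hn hp hc₁ hc₂ hW hpos hA hV hf hΛ
  set a : ℕ → (Fin d → ℝ) → ℝ≥0∞ := fun s x =>
    cubeNormAvg (normalized V f (atPt (N - s) x)) (atPt (N - s) x) with ha
  have hG : Measurable fun x => ‖mApp (W x)⁻¹ (f x)‖ₑ ^ (p / (p - 1)) :=
    (measurable_mApp (measurable_inv_apply hW) hfm).enorm.pow_const _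
  have hstep := lintegral_sum_stops_rpow_le hp hB H a
    (fun s x y h => by simp only [ha, h]) _ hG.aemeasurable
    ((n : ℝ≥0∞) ^ (p / (p - 1)) * (δ⁻¹ * (ENNReal.ofReal c₁ ^ p)⁻¹) ^ (1 / (p - 1)))
    ((1 + δ) ^ (-(1 / (p - 1)))) (fun s hs L hL hlast y hy => by
      have hy' : atPt (N - s) y = L := atPt_of_mem hy hL
      simp only [ha, hy']
      exact cubeNormAvg_rpow_mul_le hp hc₁ hW hpos hV hfm hB hδ0 hδt
        (fun e => hδ ▸ H.withDensity hB hn hp hc₁ hW hpos hV e) hs hL hlast)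
  refine le_trans ?_ (mul_le_mul_right hstep _)
  rw [← lintegral_const_mul']
  · refine lintegral_mono fun x => ?_
    rw [← ENNReal.mul_rpow_of_nonneg _ _ hq0.le]
    have h3 := sqrt_sum_le_sum_stops Bad T x
      (fun v => cubeEnergy (fun I => (V I)⁻¹) f (atPt (N - v) x)) (fun s => a s x)
      (n * Λ * (24 * 4 ^ d)) fun s t hst _ hx => sum_energy_le hf (fun I => (hV I).1) hΛ1 hst hx
    refine le_trans (le_of_eq ?_) (ENNReal.rpow_le_rpow h3 hq0.le)
    rw [← ENNReal.rpow_mul]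
    congr 1; ring
  · refine ENNReal.rpow_ne_top_of_nonneg hq0.le (ENNReal.mul_ne_top
      (ENNReal.mul_ne_top (by simp) hΛt) ?_)
    exact ENNReal.mul_ne_top (by simp) (by simp)

end SquareFunction

section Assembly

variable {d n : ℕ} {p c₁ c₂ : ℝ} {W : (Fin d → ℝ) → Matrix (Fin n) (Fin n) ℂ}
  {V : DCube d → Matrix (Fin n) (Fin n) ℂ} {f : (Fin d → ℝ) → EuclideanSpace ℂ (Fin n)}

/-- The constant in the square function bound. -/
def squareConst (d n : ℕ) (p c₁ c₂ : ℝ) : ℝ≥0∞ :=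
  n * (8 * n * (ENNReal.ofReal c₂ / ENNReal.ofReal c₁ + 1)) * (24 * 4 ^ d) *
    (stopConst p * (n : ℝ≥0∞) ^ (p / (p - 1)) * (ENNReal.ofReal c₁ ^ p)⁻¹ ^ (1 / (p - 1)) *
      ENNReal.ofReal (1 + 2 / (1 / (p - 1)))) ^ ((p - 1) / p) * 2 ^ p

theorem squareConst_lt_top (hp : 1 < p) (hc₁ : 0 < c₁) : squareConst d n p c₁ c₂ < ⊤ := by
  have hp0 : 0 < p := by linarith
  have hp1 : 0 < p - 1 := by linarith
  have hq0 : 0 ≤ p / (p - 1) := by positivity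
  have hq0' : 0 ≤ (p - 1) / p := by positivity
  have hk0 : 0 ≤ 1 / (p - 1) := by positivity
  have hc : (ENNReal.ofReal c₁ ^ p)⁻¹ ≠ ⊤ :=
    ENNReal.inv_ne_top.2 (ENNReal.rpow_pos (ENNReal.ofReal_pos.2 hc₁) (by simp)).ne'
  have hd : ENNReal.ofReal c₂ / ENNReal.ofReal c₁ ≠ ⊤ :=
    ENNReal.div_ne_top (by simp) (ENNReal.ofReal_pos.2 hc₁).ne'
  have hn : (n : ℝ≥0∞) ≠ ⊤ := by simp
  refine ENNReal.mul_lt_top (ENNReal.mul_lt_top (ENNReal.mul_lt_top (ENNReal.mul_lt_top ?_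
    (ENNReal.mul_lt_top ?_ ?_)) ?_) (ENNReal.rpow_lt_top_of_nonneg hq0' ?_)) ?_
  · simp
  · exact ENNReal.mul_lt_top (by simp) (by simp)
  · exact ENNReal.add_lt_top.2 ⟨hd.lt_top, by simp⟩
  · exact ENNReal.mul_lt_top (by simp) (by simp)
  · refine ENNReal.mul_ne_top (ENNReal.mul_ne_top (ENNReal.mul_ne_top (stopConst_lt_top hp).ne
      ?_) ?_) (by simp)
    · exact ENNReal.rpow_ne_top_of_nonneg hq0 hn
    · exact ENNReal.rpow_ne_top_of_nonneg hk0 hc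
  · exact ENNReal.rpow_lt_top_of_nonneg hp0.le (by simp)

theorem lintegral_sqFn_rpow_le (hn : 0 < n) (hp : 1 < p) (hc₁ : 0 < c₁) (hc₂ : 0 < c₂)
    (hW : MatMeasurable W) (hpos : ∀ᵐ x ∂(volume : Measure (Fin d → ℝ)), (W x).PosDef)
    (hA : apNorm p W < ⊤) (hV : IsReducing p c₁ c₂ W V) (hf : Integrable f)
    (hfm : Measurable f) :
    (∫⁻ x, sqFn (fun I => (V I)⁻¹) f x ^ ((p / (p - 1)) / 2)) ^ ((p - 1) / p) ≤
      squareConst d n p c₁ c₂ * apNorm p W ^ ((1 + p) / p) *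
        (∫⁻ x, ‖mApp (W x)⁻¹ (f x)‖ₑ ^ (p / (p - 1))) ^ ((p - 1) / p) := by
  have hp0 : 0 < p := by linarith
  have hp1 : 0 < p - 1 := by linarith
  have hq0 : 0 < p / (p - 1) := div_pos hp0 hp1
  have hr0 : 0 ≤ (p - 1) / p := by positivity
  have hκ0 : 0 < 1 / (p - 1) := by positivity
  have hqr : p / (p - 1) * ((p - 1) / p) = 1 := by field_simp
  have hκq : 1 / (p - 1) + 1 = p / (p - 1) := by field_simp; ring
  have hA1 := one_le_apNorm hn hp hc₁ hW hpos hV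
  set A := apNorm p W with hAdef
  have hA0 : A ≠ 0 := (zero_lt_one.trans_le hA1).ne'
  set D := 2 ^ p * A with hD
  have h21 : (1 : ℝ≥0∞) ≤ 2 ^ p := ENNReal.one_le_rpow (by simp) hp0
  have hD1 : 1 ≤ D := le_trans (by simp) (mul_le_mul' h21 hA1)
  have hDt : D ≠ ⊤ :=
    ENNReal.mul_ne_top (ENNReal.rpow_ne_top_of_nonneg hp0.le (by simp)) hA.ne
  have hD0 : D ≠ 0 := (zero_lt_one.trans_le hD1).ne'
  set Λ₀ : ℝ≥0∞ := 8 * n * (ENNReal.ofReal c₂ / ENNReal.ofReal c₁ + 1) with hΛ₀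
  have hc0 : ENNReal.ofReal c₁ ≠ 0 := (ENNReal.ofReal_pos.2 hc₁).ne'
  have hΛ₀t : Λ₀ ≠ ⊤ :=
    ENNReal.mul_ne_top (ENNReal.mul_ne_top (by simp) (by simp))
      (ENNReal.add_ne_top.2 ⟨ENNReal.div_ne_top (by simp) hc0, by simp⟩)
  have hn1 : (1 : ℝ≥0∞) ≤ n := by exact_mod_cast hn
  have hΛ₀1 : 1 ≤ Λ₀ := by
    calc (1 : ℝ≥0∞) = 1 * 1 * 1 := by simp
      _ ≤ Λ₀ := mul_le_mul' (mul_le_mul' (by norm_num) hn1) le_add_self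
  have hAp1 : 1 ≤ A ^ (1 / p) := ENNReal.one_le_rpow hA1 (by positivity)
  have hApt : A ^ (1 / p) ≠ ⊤ := ENNReal.rpow_ne_top_of_nonneg (by positivity) hA.ne
  have hΛ1 : 1 ≤ Λ₀ * A ^ (1 / p) := le_trans (by simp) (mul_le_mul' hΛ₀1 hAp1)
  have hΛ : 8 * n * (ENNReal.ofReal c₂ * A ^ (1 / p)) ≤
      ENNReal.ofReal c₁ * (Λ₀ * A ^ (1 / p)) := by
    have h1 : ENNReal.ofReal c₂ ≤
        ENNReal.ofReal c₁ * (ENNReal.ofReal c₂ / ENNReal.ofReal c₁ + 1) := by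
      rw [mul_add, ENNReal.mul_div_cancel hc0 (by simp)]
      exact le_self_add
    calc 8 * n * (ENNReal.ofReal c₂ * A ^ (1 / p))
        ≤ 8 * n * (ENNReal.ofReal c₁ * (ENNReal.ofReal c₂ / ENNReal.ofReal c₁ + 1) *
            A ^ (1 / p)) := mul_le_mul_right (mul_le_mul_left h1 _) _
      _ = _ := by rw [hΛ₀]; ring
  set J := ∫⁻ x, ‖mApp (W x)⁻¹ (f x)‖ₑ ^ (p / (p - 1)) with hJ
  set b := (ENNReal.ofReal c₁ ^ p)⁻¹ with hb
  set S := stopConst p * (n : ℝ≥0∞) ^ (p / (p - 1)) * b ^ (1 / (p - 1)) *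
      ENNReal.ofReal (1 + 2 / (1 / (p - 1))) with hS
  have hmain : ∫⁻ x, sqFn (fun I => (V I)⁻¹) f x ^ ((p / (p - 1)) / 2) ≤
      (n * (Λ₀ * A ^ (1 / p)) * (24 * 4 ^ d)) ^ (p / (p - 1)) * S * D ^ (p / (p - 1)) * J := by
    rw [lintegral_sqFn_rpow_eq_iSup _ _ (by positivity)]
    refine iSup_le fun M => ?_
    refine (lintegral_sum_cubeEnergy_le hn hp hc₁ hc₂ hW hpos hA hV hf hfm
      (ENNReal.mul_ne_top hΛ₀t hApt) hΛ1 hΛ M (2 * M) rfl).trans ?_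
    rw [← hAdef, ← hD, ← hJ, ← hb]
    have h4 := inv_one_sub_rpow_neg_le hκ0 (ENNReal.inv_ne_zero.2 hDt) (ENNReal.inv_le_one.2 hD1)
    rw [inv_inv] at h4 ⊢
    refine (mul_le_mul_right (mul_le_mul_left (mul_le_mul_right h4 _) _) _).trans
      (le_of_eq ?_)
    rw [ENNReal.mul_rpow_of_nonneg _ _ hκ0.le, hS, ← hκq, ENNReal.rpow_add _ _ hD0 hDt,
      ENNReal.rpow_one]
    ring
  refine (ENNReal.rpow_le_rpow hmain hr0).trans (le_of_eq ?_)
  rw [ENNReal.mul_rpow_of_nonneg _ _ hr0, ENNReal.mul_rpow_of_nonneg _ _ hr0,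
    ENNReal.mul_rpow_of_nonneg _ _ hr0, ← ENNReal.rpow_mul, ← ENNReal.rpow_mul, hqr,
    ENNReal.rpow_one, ENNReal.rpow_one]
  have hexp : A ^ ((1 + p) / p) = A ^ (1 / p) * A := by
    rw [add_div, div_self hp0.ne', ENNReal.rpow_add _ _ hA0 hA.ne, ENNReal.rpow_one]
  rw [hexp, squareConst, ← hb, ← hΛ₀, ← hS, hD]
  ring

end Assembly

/-- Let `1 < p < ∞` and let `W` be a matrix `A_p` weight on `ℝ^d` with
reducing operators `V_I`.  Then for every `f ∈ C_c^∞(ℝ^d; ℂⁿ)`,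
`(∫ (∑_{I,ε} |V_I^{-1} f_I^ε|² |I|^{-1} χ_I)^{p'/2})^{1/p'}
   ≤ C ‖W‖_{A_p}^{1/p + ⌈p⌉/p} ‖W^{-1/p} f‖_{L^{p'}}`,
where `p' = p/(p-1)` and `C = C(p, n, d)` (and the comparability constants `c₁, c₂`). -/
theorem statement13 (d n : ℕ) (hd : 0 < d) (hn : 0 < n) (p c₁ c₂ : ℝ)
    (hp : 1 < p) (hc₁ : 0 < c₁) (hc₂ : 0 < c₂) :
    ∃ C : ℝ≥0∞, 0 < C ∧ C < ⊤ ∧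
      ∀ (W1p : (Fin d → ℝ) → Matrix (Fin n) (Fin n) ℂ)
        (V : DCube d → Matrix (Fin n) (Fin n) ℂ)
        (f : (Fin d → ℝ) → EuclideanSpace ℂ (Fin n)),
        MatMeasurable W1p →
        (∀ᵐ x ∂(volume : Measure (Fin d → ℝ)), (W1p x).PosDef) →
        apNorm p W1p < ⊤ →
        IsReducing p c₁ c₂ W1p V →
        ContDiff ℝ (⊤ : ℕ∞) f →
        HasCompactSupport f →
        (∫⁻ x, sqFn (fun I => (V I)⁻¹) f x ^ ((p / (p - 1)) / 2)) ^ ((p - 1) / p) ≤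
          C * apNorm p W1p ^ ((1 + (⌈p⌉₊ : ℝ)) / p) *
            (∫⁻ x, ENNReal.ofReal ‖mApp ((W1p x)⁻¹) (f x)‖ ^ (p / (p - 1))) ^
              ((p - 1) / p) := by
  refine ⟨squareConst d n p c₁ c₂ + 1, by simp,
    ENNReal.add_lt_top.2 ⟨squareConst_lt_top hp hc₁, ENNReal.one_lt_top⟩, ?_⟩
  intro W1p V f hW hpos hA hV hf hsupp
  have hA1 := one_le_apNorm hn hp hc₁ hW hpos hV
  have hfi : Integrable f := hf.continuous.integrable_of_hasCompactSupport hsupp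
  refine (lintegral_sqFn_rpow_le hn hp hc₁ hc₂ hW hpos hA hV hfi
    hf.continuous.measurable).trans ?_
  simp_rw [ofReal_norm]
  refine mul_le_mul' (mul_le_mul' le_self_add (ENNReal.rpow_le_rpow_of_exponent_le hA1 ?_)) le_rfl
  have hceil : p ≤ ⌈p⌉₊ := Nat.le_ceil p
  gcongr

end
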